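/- Suppose n = 1, let α be a rational number with α > a₀ + a₁ + e, let H be a height associated to −K_X + αF, set A = 2+α−(a₀+a₁+a₂+e), and let U be a nonempty Zariski-open subset of X such that Δ(y) ≠ 0 and x₂ ≠ 0 at every point of U. Then for every ε > 0 there exists C_ε > 0 such that for every (y₀,y₁) ∈ O_k² with y₀O_k + y₁O_k ∈ 𝒞 and Δ(y₀,y₁) ≠ 0, and every B > 0, N(X_y ∩ U, H, B)/B ≤ C_ε · ( H(y)^{−((a₀+a₁+a₂)/3 + A) + ε} · |N_{k/ℚ}(Δ(y₀,y₁))|^{−1/3} + H(y)^{−(A+a₂) + ε} ), where y = (y₀:y₁) ∈ ℙ¹(k) and X_y = π^{−1}(y). -/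

import Mathlib

/-!
Setup (Frei–Loughran, "Rational points and non-anticanonical height functions",
§2–§3): `k` a number field, `X ⊂ F_n(a₀,a₁,a₂)` a smooth hypersurface of
bidegree `(e,2)` cut out by `Q(y,x) = ∑ f_{i,j}(y) xᵢ xⱼ`, with projection
`π : X → ℙⁿ`, discriminant `Δ(y) = det (f_{i,j}(y))`, and standard height `H*`
associated to the `ℚ`-divisor `-K_X + αF`.
-/

noncomputable section

open MvPolynomial NumberField Filter Topology IsDedekindDomain

namespace Stmt

variable (k : Type) [Field k] [NumberField k] (n : ℕ)

/-- A representative `(y, x)` of a `k`-rational point of the hypersurface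
`X : ∑_{i,j} f_{i,j}(y) xᵢxⱼ = 0` inside the bundle `F_n(a₀,a₁,a₂)`. -/
structure PtRep (f : Fin 3 → Fin 3 → MvPolynomial (Fin (n + 1)) (𝓞 k)) : Type where
  y : Fin (n + 1) → k
  x : Fin 3 → k
  hy : y ≠ 0
  hx : x ≠ 0
  hQ : ∑ i : Fin 3, ∑ j : Fin 3, (aeval y (f i j)) * x i * x j = 0

variable {k n}

/-- Two representatives give the same point of `F_n(a₀,a₁,a₂)(k)` iff they differ
by the action of `𝔾ₘ²`: `(λ,μ)·(y;x) = (λy; λ^{-a₀}μx₀, λ^{-a₁}μx₁, λ^{-a₂}μx₂)`. -/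
def ptRel (a : Fin 3 → ℤ) (f : Fin 3 → Fin 3 → MvPolynomial (Fin (n + 1)) (𝓞 k))
    (P P' : PtRep k n f) : Prop :=
  ∃ l m : kˣ, (∀ i, P'.y i = (l : k) * P.y i) ∧
    ∀ j, P'.x j = ((l ^ (-(a j)) * m : kˣ) : k) * P.x j

/-- The counting function `N(U, H, B)`: the number of points of `X(k)` lying in `U`
and of height at most `B`.  (Points of `X(k)` are classes of representatives.) -/
def Ncount (a : Fin 3 → ℤ) (f : Fin 3 → Fin 3 → MvPolynomial (Fin (n + 1)) (𝓞 k))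
    (U : Set (PtRep k n f)) (H : PtRep k n f → ℝ) (B : ℝ) : ℕ :=
  Nat.card {q : Quot (ptRel a f) // ∃ P, P ∈ U ∧ H P ≤ B ∧ Quot.mk (ptRel a f) P = q}

/-- `max_i |z i|_w` at an infinite place `w`. -/
def maxAt {ι : Type} [Fintype ι] [Nonempty ι] (w : InfinitePlace k) (z : ι → k) : ℝ :=
  Finset.univ.sup' Finset.univ_nonempty fun i => w (z i)

/-- The normalized absolute value `|z|_v^{m_v} = 𝔑(𝔭_v)^{-ord_v(z)}` attached to a
finite place (height-one prime) `v` of `k`. -/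
def fnorm (v : HeightOneSpectrum (𝓞 k)) (z : k) : ℝ :=
  if h : v.valuation k z = 0 then 0
  else (Ideal.absNorm v.asIdeal : ℝ) ^ (Multiplicative.toAdd (WithZero.unzero h))

/-- `max_i |z i|_v^{m_v}` at a finite place `v`. -/
def maxAtFin {ι : Type} [Fintype ι] [Nonempty ι] (v : HeightOneSpectrum (𝓞 k)) (z : ι → k) : ℝ :=
  Finset.univ.sup' Finset.univ_nonempty fun i => fnorm v (z i)

/-- The exponent `A = n + 1 + α - (a₀ + a₁ + a₂ + e)`. -/
def Aexp (n : ℕ) (a : Fin 3 → ℤ) (e : ℤ) (α : ℚ) : ℝ :=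
  (n : ℝ) + 1 + (α : ℝ) - (((a 0 : ℤ) : ℝ) + ((a 1 : ℤ) : ℝ) + ((a 2 : ℤ) : ℝ) + (e : ℝ))

/-- The standard height `H*(y;x) = ∏_v (max_i |y_i|_v^A · max_j (max_i |y_i|_v^{a_j} |x_j|_v))^{m_v}`
associated to the `ℚ`-divisor `-K_X + αF = M + AF`. -/
def Hstd (a : Fin 3 → ℤ) (e : ℤ) (α : ℚ)
    (f : Fin 3 → Fin 3 → MvPolynomial (Fin (n + 1)) (𝓞 k)) (P : PtRep k n f) : ℝ :=
  (∏ w : InfinitePlace k,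
      (maxAt w P.y ^ Aexp n a e α *
        Finset.univ.sup' Finset.univ_nonempty
          (fun j => maxAt w P.y ^ ((a j : ℤ) : ℝ) * w (P.x j))) ^ w.mult) *
  ∏ᶠ v : HeightOneSpectrum (𝓞 k),
      (maxAtFin v P.y ^ Aexp n a e α *
        Finset.univ.sup' Finset.univ_nonempty
          (fun j => maxAtFin v P.y ^ ((a j : ℤ) : ℝ) * fnorm v (P.x j)))

/-- The defining polynomial `Q = ∑_{i,j} f_{i,j}(y) xᵢxⱼ`, as a polynomial over `k`
  in the variables `y₀, …, y_n, x₀, x₁, x₂`. -/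
def Qk (f : Fin 3 → Fin 3 → MvPolynomial (Fin (n + 1)) (𝓞 k)) :
    MvPolynomial (Fin (n + 1) ⊕ Fin 3) k :=
  ∑ i : Fin 3, ∑ j : Fin 3,
    rename Sum.inl (map (algebraMap (𝓞 k) k) (f i j)) * X (Sum.inr i) * X (Sum.inr j)

/-- Smoothness of the hypersurface `X : Q = 0`: at every point over an algebraic
closure of `k` (with `y ≠ 0`, `x ≠ 0`) where `Q` vanishes, some partial derivative
of `Q` is nonzero. -/
def IsSmoothX (f : Fin 3 → Fin 3 → MvPolynomial (Fin (n + 1)) (𝓞 k)) : Prop :=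
  ∀ y : Fin (n + 1) → AlgebraicClosure k, ∀ x : Fin 3 → AlgebraicClosure k,
    y ≠ 0 → x ≠ 0 → aeval (Sum.elim y x) (Qk f) = 0 →
      ∃ s, aeval (Sum.elim y x) (pderiv s (Qk f)) ≠ 0

/-- The coefficients `f_{i,j}` are symmetric and homogeneous of degree `aᵢ + aⱼ + e`,
so that `Q` is bihomogeneous of bidegree `(e,2)` on `F_n(a₀,a₁,a₂)`. -/
def DegOK (a : Fin 3 → ℤ) (e : ℤ) (f : Fin 3 → Fin 3 → MvPolynomial (Fin (n + 1)) (𝓞 k)) : Prop :=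
  ∀ i j, f i j = f j i ∧ (f i j).IsHomogeneous (a i + a j + e).toNat ∧
    (a i + a j + e < 0 → f i j = 0)

/-- The discriminant `Δ(y) = det (f_{i,j}(y))`, evaluated at `y ∈ kⁿ⁺¹`. -/
def Deltak (f : Fin 3 → Fin 3 → MvPolynomial (Fin (n + 1)) (𝓞 k))
    (y : Fin (n + 1) → k) : k :=
  Matrix.det (Matrix.of fun i j => aeval y (f i j))

/-- A polynomial in the Cox ring of `F_n(a₀,a₁,a₂)` is bihomogeneous (of some bidegree
`(d₁,d₂)`) with respect to the `𝔾ₘ²`-action; the nonvanishing loci of such polynomials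
define the open subsets of `F_n(a₀,a₁,a₂)`. -/
def IsBihom (a : Fin 3 → ℤ) (g : MvPolynomial (Fin (n + 1) ⊕ Fin 3) k) : Prop :=
  ∃ (d₁ : ℤ) (d₂ : ℕ), ∀ (l m : kˣ) (y : Fin (n + 1) → k) (x : Fin 3 → k),
    eval (Sum.elim (fun i => (l : k) * y i) fun j => ((l ^ (-(a j)) * m : kˣ) : k) * x j) g =
      (l : k) ^ d₁ * (m : k) ^ d₂ * eval (Sum.elim y x) g

/-- The set of representatives of points of `X(k)` lying in the fibre `X_y = π⁻¹(y)`
above the point `y = (y₀ : y₁) ∈ ℙ¹(k)`. -/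
def fiberSet (f : Fin 3 → Fin 3 → MvPolynomial (Fin (n + 1)) (𝓞 k))
    (y : Fin (n + 1) → k) : Set (PtRep k n f) :=
  {P | ∃ l : kˣ, ∀ i, P.y i = (l : k) * y i}

/-- The value `Δ(𝐲) = det (f_{i,j}(𝐲)) ∈ O_k` at an integral point `𝐲`. -/
def DeltaO (f : Fin 3 → Fin 3 → MvPolynomial (Fin (n + 1)) (𝓞 k))
    (z : Fin (n + 1) → 𝓞 k) : 𝓞 k :=
  Matrix.det (Matrix.of fun i j => eval z (f i j))

/-- The standard (absolute, multiplicative) projective height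
`H(y) = ∏_v max_i |y_i|_v^{m_v}` of a point of `ℙⁿ(k)`, computed on a
representative (well-defined by the product formula). -/
def Hproj {ι : Type} [Fintype ι] [Nonempty ι] (z : ι → k) : ℝ :=
  (∏ w : InfinitePlace k, maxAt w z ^ w.mult) * ∏ᶠ v : HeightOneSpectrum (𝓞 k), maxAtFin v z

/-- The bilinear form with Gram matrix `F`. -/
def bil {R : Type*} [CommRing R] (F : Matrix (Fin 3) (Fin 3) R) (x y : Fin 3 → R) : R :=
  ∑ i, ∑ j, F i j * x i * y j

/-- The determinant of three vectors. -/
def det3 {R : Type*} [CommRing R] (x y w : Fin 3 → R) : R :=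
  x 0 * (y 1 * w 2 - y 2 * w 1) - x 1 * (y 0 * w 2 - y 2 * w 0) + x 2 * (y 0 * w 1 - y 1 * w 0)

section Bilinear

variable {R : Type*} [CommRing R]

theorem bil_comm {F : Matrix (Fin 3) (Fin 3) R} (hF : ∀ i j, F i j = F j i) (x y : Fin 3 → R) :
    bil F x y = bil F y x := by
  simp only [bil, Fin.sum_univ_three]
  rw [hF 1 0, hF 2 0, hF 2 1]
  ring

theorem det_gram (F : Matrix (Fin 3) (Fin 3) R) (x y w : Fin 3 → R) :
    F.det * det3 x y w ^ 2 =
      (Matrix.of ![![bil F x x, bil F x y, bil F x w], ![bil F y x, bil F y y, bil F y w],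
        ![bil F w x, bil F w y, bil F w w]]).det := by
  have h : Matrix.of ![![bil F x x, bil F x y, bil F x w], ![bil F y x, bil F y y, bil F y w],
        ![bil F w x, bil F w y, bil F w w]] =
      Matrix.of ![x, y, w] * F * (Matrix.of ![x, y, w]).transpose := by
    ext i j
    fin_cases i <;> fin_cases j <;>
      simp [bil, Matrix.mul_apply, Matrix.vecMul, dotProduct, Fin.sum_univ_three] <;> ring
  have h2 : (Matrix.of ![x, y, w]).det = det3 x y w := by
    simp [Matrix.det_fin_three, det3]; ring
  rw [h, Matrix.det_mul, Matrix.det_mul, Matrix.det_transpose, h2]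
  ring

theorem det_mul_det3_sq {F : Matrix (Fin 3) (Fin 3) R} (hF : ∀ i j, F i j = F j i)
    {x y w : Fin 3 → R} (hx : bil F x x = 0) (hy : bil F y y = 0) (hw : bil F w w = 0) :
    F.det * det3 x y w ^ 2 = 2 * bil F x y * bil F x w * bil F y w := by
  rw [det_gram, bil_comm hF y x, bil_comm hF w x, bil_comm hF w y, hx, hy, hw]
  simp [Matrix.det_fin_three]
  ring

/-- A nondegenerate ternary form has no totally isotropic plane. -/
theorem cross_eq_zero_of_isotropic [IsDomain R] {F : Matrix (Fin 3) (Fin 3) R}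
    (hF : ∀ i j, F i j = F j i) (hdet : F.det ≠ 0)
    {x y : Fin 3 → R} (hx : bil F x x = 0) (hy : bil F y y = 0) (hxy : bil F x y = 0)
    (i j : Fin 3) : x i * y j = x j * y i := by
  have key : ∀ w, det3 x y w = 0 := by
    intro w
    have h := det_gram F x y w
    rw [bil_comm hF y x, hx, hy, hxy] at h
    simp [Matrix.det_fin_three] at h
    rw [Matrix.det_fin_three] at hdet
    exact h.resolve_left hdet
  have h0 := key ![1, 0, 0]
  have h1 := key ![0, 1, 0]
  have h2 := key ![0, 0, 1]
  simp [det3] at h0 h1 h2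
  fin_cases i <;> fin_cases j <;> simp <;> grind

/-- The multiplier by which a ternary form becomes a sum of three squares of linear forms (with
coefficients) after the substitution given by `P`. -/
def pivot (P F : Matrix (Fin 3) (Fin 3) R) : R :=
  bil F (P 0) (P 0) * (bil F (P 0) (P 0) * bil F (P 1) (P 1) - bil F (P 0) (P 1) ^ 2) * P.det ^ 2

theorem exists_diagonalization {F : Matrix (Fin 3) (Fin 3) R} (hF : ∀ i j, F i j = F j i)
    (P : Matrix (Fin 3) (Fin 3) R) :
    ∃ (s t u : (Fin 3 → R) → R) (d g : R), ∀ x y,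
      pivot P F * bil F x y = s x * s y + d * (t x * t y) + F.det * (g * (u x * u y)) := by
  have hbas : ∀ x : Fin 3 → R, ∃ X : Fin 3 → R,
      P.det • x = X 0 • P 0 + X 1 • P 1 + X 2 • P 2 := by
    intro x
    refine ⟨P.adjugate.transpose.mulVec x, ?_⟩
    have h : (P.transpose * P.adjugate.transpose).mulVec x = P.det • x := by
      rw [← Matrix.transpose_mul, Matrix.adjugate_mul, Matrix.transpose_smul,
        Matrix.transpose_one, Matrix.smul_mulVec, Matrix.one_mulVec]
    rw [← h, ← Matrix.mulVec_mulVec]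
    ext i
    simp [Matrix.mulVec, dotProduct, Fin.sum_univ_three]
    ring
  choose X hX using hbas
  set A := bil F (P 0) (P 0) with hA
  set B := bil F (P 0) (P 1) with hB
  set E := bil F (P 0) (P 2) with hE
  set C := bil F (P 1) (P 1) with hC
  set H := bil F (P 1) (P 2) with hH
  set J := bil F (P 2) (P 2) with hJ
  have hdetG : F.det * P.det ^ 2 = A * (C * J - H ^ 2) - B * (B * J - H * E) +
      E * (B * H - C * E) := by
    have h := det_gram F (P 0) (P 1) (P 2)
    have h2 : det3 (P 0) (P 1) (P 2) = P.det := by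
      simp [Matrix.det_fin_three, det3]; ring
    rw [h2, bil_comm hF (P 1) (P 0), bil_comm hF (P 2) (P 0), bil_comm hF (P 2) (P 1)] at h
    rw [h]
    simp [Matrix.det_fin_three, ← hA, ← hB, ← hC, ← hE, ← hH, ← hJ]
    ring
  refine ⟨fun x => (A * C - B ^ 2) * X x 1 + (A * H - B * E) * X x 2,
    fun x => A * X x 0 + B * X x 1 + E * X x 2, fun x => X x 2, A * C - B ^ 2, A * P.det ^ 2, ?_⟩
  intro x y
  have h1 : P.det ^ 2 * bil F x y = bil F (P.det • x) (P.det • y) := by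
    simp [bil, Fin.sum_univ_three]; ring
  have h2 : bil F (P.det • x) (P.det • y) =
      A * (X x 0 * X y 0) + B * (X x 0 * X y 1 + X x 1 * X y 0)
      + E * (X x 0 * X y 2 + X x 2 * X y 0) + C * (X x 1 * X y 1)
      + H * (X x 1 * X y 2 + X x 2 * X y 1) + J * (X x 2 * X y 2) := by
    have hlin1 : ∀ (a b c : R) (p q r w : Fin 3 → R), bil F (a • p + b • q + c • r) w =
        a * bil F p w + b * bil F q w + c * bil F r w := by
      intros; simp [bil, Fin.sum_univ_three]; ring
    have hlin2 : ∀ (a b c : R) (p q r w : Fin 3 → R), bil F w (a • p + b • q + c • r) =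
        a * bil F w p + b * bil F w q + c * bil F w r := by
      intros; simp [bil, Fin.sum_univ_three]; ring
    rw [hX x, hX y, hlin1, hlin2, hlin2, hlin2, bil_comm hF (P 1) (P 0), bil_comm hF (P 2) (P 0),
      bil_comm hF (P 2) (P 1), ← hA, ← hB, ← hC, ← hE, ← hH, ← hJ]
    ring
  rw [h2] at h1
  simp only [pivot, ← hA, ← hB, ← hC]
  linear_combination (A * (A * C - B ^ 2)) * h1 - A * X x 2 * X y 2 * hdetG

end Bilinear

section Order

variable {R : Type*} [CommRing R] [IsDedekindDomain R]

/-- The order of vanishing of `a` at the height-one prime `v`. -/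
def ordAt (v : HeightOneSpectrum R) (a : R) : ℕ∞ := emultiplicity v.asIdeal (Ideal.span {a})

theorem le_ordAt {v : HeightOneSpectrum R} {a : R} {n : ℕ} :
    (n : ℕ∞) ≤ ordAt v a ↔ a ∈ v.asIdeal ^ n := by
  rw [ordAt, ← pow_dvd_iff_le_emultiplicity, Ideal.dvd_span_singleton]

theorem ordAt_mul (v : HeightOneSpectrum R) (a b : R) :
    ordAt v (a * b) = ordAt v a + ordAt v b := by
  rw [ordAt, ordAt, ordAt, ← Ideal.span_singleton_mul_span_singleton, emultiplicity_mul v.prime]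

theorem ordAt_pow (v : HeightOneSpectrum R) (a : R) (n : ℕ) :
    ordAt v (a ^ n) = n * ordAt v a := by
  rw [ordAt, ordAt, ← Ideal.span_singleton_pow, emultiplicity_pow v.prime]

theorem ordAt_eq_top {v : HeightOneSpectrum R} {a : R} : ordAt v a = ⊤ ↔ a = 0 := by
  constructor
  · intro h
    by_contra ha
    have hfin : FiniteMultiplicity v.asIdeal (Ideal.span {a}) :=
      FiniteMultiplicity.of_prime_left v.prime (by simpa using ha)
    exact (finiteMultiplicity_iff_emultiplicity_ne_top.1 hfin) h
  · rintro rfl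
    simp [ordAt]

theorem exists_ordAt_eq (v : HeightOneSpectrum R) {a : R} (ha : a ≠ 0) :
    ∃ n : ℕ, ordAt v a = n := by
  obtain ⟨n, hn⟩ := ENat.ne_top_iff_exists.1 (mt (ordAt_eq_top (v := v)).1 ha)
  exact ⟨n, hn.symm⟩

theorem mem_pow_of_mul_mem_pow {v : HeightOneSpectrum R} {a b : R} {m e : ℕ}
    (ha : ordAt v a ≤ m) (h : a * b ∈ v.asIdeal ^ (m + e)) : b ∈ v.asIdeal ^ e := by
  rw [← le_ordAt] at h ⊢
  rw [ordAt_mul] at h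
  have h' : ((m + e : ℕ) : ℕ∞) ≤ m + ordAt v b := h.trans (by gcongr)
  push_cast at h'
  exact (ENat.add_le_add_iff_left (ENat.natCast_ne_top m)).1 h'

theorem mul_mem_pow_add {R : Type*} [CommRing R] {v : HeightOneSpectrum R} {a b : R} {m e : ℕ}
    (ha : a ∈ v.asIdeal ^ m) (hb : b ∈ v.asIdeal ^ e) : a * b ∈ v.asIdeal ^ (m + e) := by
  rw [pow_add]; exact Ideal.mul_mem_mul ha hb

theorem sq_mem_pow_iff {v : HeightOneSpectrum R} {a : R} {n : ℕ} :
    a ^ 2 ∈ v.asIdeal ^ (2 * n) ↔ a ∈ v.asIdeal ^ n := by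
  constructor
  · intro h
    rw [← le_ordAt, ordAt_pow] at h
    rw [← le_ordAt]
    by_contra! hlt
    obtain ⟨m, hm⟩ := ENat.ne_top_iff_exists.1 hlt.ne_top
    rw [← hm] at h hlt
    norm_cast at h hlt
    omega
  · intro h
    rw [mul_comm, pow_mul]
    exact Ideal.pow_mem_pow h 2

/-- The integral points with `s² + d t² ≡ 0` modulo `v ^ e` fall into few classes, in each of which
the associated bilinear form is divisible by `v ^ e`. -/
theorem exists_classes_binary (v : HeightOneSpectrum R) (e : ℕ) {T : Type*} (s t : T → R) (d : R)
    (h : ∀ p, s p ^ 2 + d * t p ^ 2 ∈ v.asIdeal ^ e) :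
    ∃ cl : T → Fin (2 * e + 1), ∀ p q, cl p = cl q →
      2 * (s p * s q + d * (t p * t q)) ∈ v.asIdeal ^ e := by
  classical
  by_cases hall : ∀ p, t p ^ 2 ∈ v.asIdeal ^ e
  · refine ⟨fun _ => 0, fun p q _ => ?_⟩
    have hmul : ∀ {a b : R}, a ^ 2 ∈ v.asIdeal ^ e → b ^ 2 ∈ v.asIdeal ^ e →
        a * b ∈ v.asIdeal ^ e := by
      intro a b ha hb
      rw [← sq_mem_pow_iff, mul_pow, two_mul]
      exact mul_mem_pow_add ha hb
    have hs : ∀ p, s p ^ 2 ∈ v.asIdeal ^ e := fun p => by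
      have := Ideal.sub_mem _ (h p) (Ideal.mul_mem_left _ d (hall p))
      simpa using this
    exact Ideal.mul_mem_left _ _ (Ideal.add_mem _ (hmul (hs p) (hs q))
      (Ideal.mul_mem_left _ _ (hmul (hall p) (hall q))))
  push Not at hall
  obtain ⟨p1, hp1⟩ := hall
  obtain ⟨p0, hp0⟩ : ∃ p0, ∀ p, ordAt v (t p0) ≤ ordAt v (t p) := by
    have : Nonempty T := ⟨p1⟩
    exact ⟨Function.argmin fun p => ordAt v (t p), fun p => 
      Function.argmin_le (fun p => ordAt v (t p)) p⟩
  have hlt : 2 * ordAt v (t p0) < e := by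
    have h1 : ¬ (e : ℕ∞) ≤ ordAt v (t p1 ^ 2) := fun hh => hp1 (le_ordAt.1 hh)
    rw [ordAt_pow, not_le] at h1
    refine lt_of_le_of_lt ?_ h1
    push_cast
    gcongr
    exact hp0 p1
  obtain ⟨τ, hτ⟩ : ∃ τ : ℕ, ordAt v (t p0) = τ := by
    apply exists_ordAt_eq
    intro h0
    rw [ordAt_eq_top.2 h0] at hlt
    simp at hlt
  have hτe : 2 * τ < e := by
    rw [hτ] at hlt
    exact_mod_cast hlt
  have htp : ∀ p, t p ∈ v.asIdeal ^ τ := fun p => le_ordAt.1 (hτ ▸ hp0 p)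
  set L1 : T → R := fun p => s p * t p0 - s p0 * t p with hL1
  set L2 : T → R := fun p => s p * t p0 + s p0 * t p with hL2
  have hL : ∀ p, L1 p * L2 p ∈ v.asIdeal ^ (e + 2 * τ) := by
    intro p
    have e1 : L1 p * L2 p = (s p ^ 2 + d * t p ^ 2) * t p0 ^ 2
        - (s p0 ^ 2 + d * t p0 ^ 2) * t p ^ 2 := by
      simp only [hL1, hL2]; ring
    rw [e1]
    exact Ideal.sub_mem _ (mul_mem_pow_add (h p) (sq_mem_pow_iff.2 (htp p0)))
      (mul_mem_pow_add (h p0) (sq_mem_pow_iff.2 (htp p)))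
  let N : T → ℕ := fun p => (min (ordAt v (L1 p)) ((e + 2 * τ : ℕ) : ℕ∞)).toNat
  have hN : ∀ p, (N p : ℕ∞) = min (ordAt v (L1 p)) ((e + 2 * τ : ℕ) : ℕ∞) := fun p =>
    ENat.natCast_toNat (ne_top_of_le_ne_top (ENat.natCast_ne_top _) (min_le_right _ _))
  have hNle : ∀ p, N p ≤ e + 2 * τ := fun p => by
    have := (hN p).le.trans (min_le_right _ _)
    exact_mod_cast this
  have hN1 : ∀ p, L1 p ∈ v.asIdeal ^ N p := fun p =>
    le_ordAt.1 ((hN p).le.trans (min_le_left _ _))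
  have hN2 : ∀ p, L2 p ∈ v.asIdeal ^ (e + 2 * τ - N p) := by
    intro p
    rcases (hNle p).eq_or_lt with heq | hlt'
    · rw [heq]; simp
    · have hord : ordAt v (L1 p) ≤ N p := by
        rw [hN p]
        refine le_min le_rfl ?_
        by_contra! hc
        have := hN p
        rw [min_eq_right hc.le] at this
        norm_cast at this
        omega
      apply mem_pow_of_mul_mem_pow hord
      rw [Nat.add_sub_cancel' hlt'.le]
      exact hL p
  refine ⟨fun p => ⟨N p, by have := hNle p; omega⟩, fun p q hpq => ?_⟩
  have hpq' : N p = N q := by simpa using hpq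
  have hm : ordAt v (t p0 ^ 2) ≤ ((2 * τ : ℕ) : ℕ∞) := by
    rw [ordAt_pow, hτ]; push_cast; rfl
  apply mem_pow_of_mul_mem_pow hm
  have e2 : t p0 ^ 2 * (2 * (s p * s q + d * (t p * t q))) =
      L1 p * L2 q + L1 q * L2 p + 2 * (s p0 ^ 2 + d * t p0 ^ 2) * (t p * t q) := by
    simp only [hL1, hL2]; ring
  rw [e2, add_comm (2 * τ) e]
  have c1 := mul_mem_pow_add (hN1 p) (hN2 q)
  have c2 := mul_mem_pow_add (hN1 q) (hN2 p)
  rw [← hpq', Nat.add_sub_cancel' (hNle p)] at c1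
  rw [← hpq', Nat.add_sub_cancel' (hNle p)] at c2
  refine Ideal.add_mem _ (Ideal.add_mem _ c1 c2) (mul_mem_pow_add
    (Ideal.mul_mem_left _ _ (h p0)) ?_)
  rw [two_mul]
  exact mul_mem_pow_add (htp p) (htp q)

/-- At a prime dividing the determinant, the solutions of a ternary quadratic equation fall into few
classes, in each of which any three solutions have highly divisible determinant. -/
theorem exists_classes_bad (v : HeightOneSpectrum R) {F : Matrix (Fin 3) (Fin 3) R}
    (hF : ∀ i j, F i j = F j i) {e : ℕ} (he : ordAt v F.det = e)
    {P : Matrix (Fin 3) (Fin 3) R} {β : R} (hβ : ordAt v (pivot P F) ≤ ordAt v β)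
    {T : Type*} (x : T → Fin 3 → R) (hx : ∀ p, bil F (x p) (x p) = 0) :
    ∃ cl : T → Fin (2 * e + 1), ∀ p q r, cl p = cl q → cl q = cl r →
      4 * β ^ 3 * det3 (x p) (x q) (x r) ^ 2 ∈ v.asIdeal ^ (2 * e) := by
  obtain ⟨s, t, u, d, g, hdiag⟩ := exists_diagonalization hF P
  have hdet : F.det ∈ v.asIdeal ^ e := le_ordAt.1 he.ge
  obtain ⟨cl, hcl⟩ := exists_classes_binary v e (fun p => s (x p)) (fun p => t (x p)) d (by
    intro p
    have := hdiag (x p) (x p)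
    rw [hx p, mul_zero] at this
    have h2 : s (x p) ^ 2 + d * t (x p) ^ 2 = -(F.det * (g * (u (x p) * u (x p)))) := by
      linear_combination -this
    rw [h2]
    exact neg_mem (Ideal.mul_mem_right _ _ hdet))
  have hb : ∀ p q, cl p = cl q → 2 * pivot P F * bil F (x p) (x q) ∈ v.asIdeal ^ e := by
    intro p q hpq
    rw [mul_assoc, hdiag, mul_add]
    exact Ideal.add_mem _ (hcl p q hpq) (Ideal.mul_mem_left _ _ (Ideal.mul_mem_right _ _ hdet))
  refine ⟨cl, fun p q r hpq hqr => ?_⟩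
  have h3 : F.det * (4 * pivot P F ^ 3 * det3 (x p) (x q) (x r) ^ 2) ∈ v.asIdeal ^ (e + 2 * e) := by
    have e1 : F.det * (4 * pivot P F ^ 3 * det3 (x p) (x q) (x r) ^ 2) =
        (2 * pivot P F * bil F (x p) (x q)) * ((2 * pivot P F * bil F (x p) (x r)) *
          (2 * pivot P F * bil F (x q) (x r))) := by
      linear_combination (4 * pivot P F ^ 3) * det_mul_det3_sq hF (hx p) (hx q) (hx r)
    rw [e1, two_mul]
    exact mul_mem_pow_add (hb _ _ hpq) (mul_mem_pow_add (hb _ _ (hpq.trans hqr)) (hb _ _ hqr))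
  have h4 := mem_pow_of_mul_mem_pow he.le h3
  rw [← le_ordAt] at h4 ⊢
  refine h4.trans ?_
  rw [ordAt_mul, ordAt_mul, ordAt_mul, ordAt_mul, ordAt_pow, ordAt_pow _ β]
  gcongr

end Order

section GoodPrime

variable {R : Type*} [CommRing R] [IsDedekindDomain R]

theorem ordAt_le_zero {v : HeightOneSpectrum R} {a : R} (ha : a ∉ v.asIdeal) :
    ordAt v a ≤ ((0 : ℕ) : ℕ∞) := by
  by_contra! h
  have h1 : ((1 : ℕ) : ℕ∞) ≤ ordAt v a := by
    push_cast
    exact Order.one_le_iff_pos.2 (by simpa using h)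
  rw [le_ordAt, pow_one] at h1
  exact ha h1

theorem mem_pow_of_mul_mem {v : HeightOneSpectrum R} {a b : R} {e : ℕ}
    (ha : a ∉ v.asIdeal) (h : a * b ∈ v.asIdeal ^ e) : b ∈ v.asIdeal ^ e :=
  mem_pow_of_mul_mem_pow (ordAt_le_zero ha) (by rwa [zero_add])

theorem exists_inverse_mod_pow {v : HeightOneSpectrum R} {a : R} (ha : a ∉ v.asIdeal) (m : ℕ) :
    ∃ y, y * a - 1 ∈ v.asIdeal ^ m := by
  have hmax := v.isMaximal
  have h : IsCoprime (Ideal.span {a}) (v.asIdeal ^ m) := by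
    apply IsCoprime.pow_right
    rw [Ideal.isCoprime_iff_sup_eq, sup_comm]
    refine hmax.1.2 _ (lt_of_le_of_ne le_sup_left ?_)
    intro h
    exact ha (h ▸ Ideal.mem_sup_right (Ideal.mem_span_singleton_self a))
  obtain ⟨i, hi, j, hj, hij⟩ := (Ideal.isCoprime_iff_exists).1 h
  obtain ⟨y, rfl⟩ := Ideal.mem_span_singleton'.1 hi
  refine ⟨y, ?_⟩
  have : y * a - 1 = -j := by rw [← hij]; ring
  rw [this]
  exact neg_mem hj

/-- The Hensel-type uniqueness on a smooth conic: two normalized points agreeing to high order in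
one coordinate and to first order in the other agree to high order. -/
theorem sub_mem_pow_of_smooth (v : HeightOneSpectrum R) {F : Matrix (Fin 3) (Fin 3) R}
    (hF : ∀ i j, F i j = F j i) {m : ℕ} {x y : Fin 3 → R}
    (hx : bil F x x = 0) (hy : bil F y y = 0) (i j : Fin 3) (hij : i ≠ j)
    (hi : y i - x i ∈ v.asIdeal ^ m) (hl : y (-(i + j)) - x (-(i + j)) ∈ v.asIdeal ^ m)
    (hj : y j - x j ∈ v.asIdeal) (hj2 : 2 * ∑ a, F j a * x a ∉ v.asIdeal) (a : Fin 3) :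
    y a - x a ∈ v.asIdeal ^ m := by
  set l := -(i + j) with hldef
  have hsum : ∀ g : Fin 3 → R, ∑ a, g a = g i + g j + g l := by
    intro g
    rw [hldef, Fin.sum_univ_three]
    fin_cases i <;> fin_cases j <;> simp at hij ⊢ <;> ring!
  have hall : ∀ a, a = i ∨ a = j ∨ a = l := by
    rw [hldef]; clear * - hij; revert i j; decide
  have hu : 2 * ∑ a, F j a * x a + F j j * (y j - x j) ∉ v.asIdeal := fun h => hj2 (by
    have := Ideal.sub_mem _ h (Ideal.mul_mem_left _ (F j j) hj)
    simpa using this)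
  have hjm : y j - x j ∈ v.asIdeal ^ m := by
    apply mem_pow_of_mul_mem hu
    have e1 : (2 * ∑ a, F j a * x a + F j j * (y j - x j)) * (y j - x j) =
        (y i - x i) * (-(2 * ∑ a, F i a * x a) - F i i * (y i - x i) - 2 * F i j * (y j - x j)
          - 2 * F i l * (y l - x l)) +
        (y l - x l) * (-(2 * ∑ a, F l a * x a) - F l l * (y l - x l) - 2 * F j l * (y j - x j)) := by
      simp only [bil, hsum] at hx hy ⊢
      rw [hF j i, hF l i, hF l j] at hx hy ⊢
      linear_combination hy - hx
    rw [e1]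
    exact Ideal.add_mem _ (Ideal.mul_mem_right _ _ hi) (Ideal.mul_mem_right _ _ hl)
  rcases hall a with rfl | rfl | rfl
  · exact hi
  · exact hjm
  · exact hl

/-- At a prime of good reduction, the primitive solutions of a ternary quadratic equation fall into
few classes, in each of which any three solutions have highly divisible determinant. -/
theorem exists_classes_good (v : HeightOneSpectrum R) {F : Matrix (Fin 3) (Fin 3) R}
    (hF : ∀ i j, F i j = F j i) (hdet : 2 * F.det ∉ v.asIdeal) {m : ℕ} (hm : m ≠ 0)
    {T : Type*} (x : T → Fin 3 → R) (hx : ∀ p, bil F (x p) (x p) = 0)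
    (hprim : ∀ p, ∃ i, x p i ∉ v.asIdeal) :
    ∃ cl : T → (Fin 3 × Fin 3) × (R ⧸ v.asIdeal ^ m) × (R ⧸ v.asIdeal),
      ∀ p q r, cl p = cl q → cl q = cl r → det3 (x p) (x q) (x r) ∈ v.asIdeal ^ (3 * m) := by
  have hP := v.isPrime
  have h2 : (2 : R) ∉ v.asIdeal := fun h => hdet (Ideal.mul_mem_right _ _ h)
  have hd : F.det ∉ v.asIdeal := fun h => hdet (Ideal.mul_mem_left _ _ h)
  choose i hi using hprim
  choose c hc using fun p => exists_inverse_mod_pow (hi p) m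
  have hcv : ∀ p, c p ∉ v.asIdeal := by
    intro p h
    apply v.isPrime.ne_top
    rw [Ideal.eq_top_iff_one]
    have h1 := Ideal.pow_le_self hm (hc p)
    have := Ideal.sub_mem _ (Ideal.mul_mem_right (x p (i p)) _ h) h1
    simpa using this
  set X : T → Fin 3 → R := fun p a => c p * x p a with hXdef
  have hX : ∀ p, bil F (X p) (X p) = 0 := by
    intro p
    have : bil F (X p) (X p) = c p ^ 2 * bil F (x p) (x p) := by
      simp [hXdef, bil, Fin.sum_univ_three]; ring
    rw [this, hx, mul_zero]
  have hj : ∀ p, ∃ j, i p ≠ j ∧ ∑ a, F j a * X p a ∉ v.asIdeal := by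
    intro p
    by_contra! hcon
    have hi' : X p (i p) ∉ v.asIdeal := fun h => (hP.mem_or_mem h).elim (hcv p) (hi p)
    have hall : ∀ j, ∑ a, F j a * X p a ∈ v.asIdeal := by
      intro j
      by_cases hij : i p = j
      · have hQ : ∑ j, X p j * ∑ a, F j a * X p a = 0 := by
          rw [← hX p]
          simp [bil, Fin.sum_univ_three]; ring
        rw [← Finset.add_sum_erase _ _ (Finset.mem_univ (i p))] at hQ
        have : X p (i p) * ∑ a, F (i p) a * X p a ∈ v.asIdeal := by
          rw [eq_neg_of_add_eq_zero_left hQ]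
          refine neg_mem (Ideal.sum_mem _ fun b hb => Ideal.mul_mem_left _ _ ?_)
          exact hcon b (Finset.ne_of_mem_erase hb).symm
        exact hij ▸ (hP.mem_or_mem this).resolve_left hi'
      · exact hcon j hij
    have hadj : F.det * X p (i p) = ∑ j, F.adjugate (i p) j * ∑ a, F j a * X p a := by
      have h := congrFun (congrArg (fun M : Matrix (Fin 3) (Fin 3) R => M.mulVec (X p))
        (Matrix.adjugate_mul F)) (i p)
      simp only [← Matrix.mulVec_mulVec, Matrix.smul_mulVec, Matrix.one_mulVec] at h
      simpa [Matrix.mulVec, dotProduct] using h.symm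
    have : F.det * X p (i p) ∈ v.asIdeal := by
      rw [hadj]
      exact Ideal.sum_mem _ fun b _ => Ideal.mul_mem_left _ _ (hall b)
    exact (hP.mem_or_mem this).elim hd hi'
  choose j hij hj using hj
  refine ⟨fun p => ((i p, j p), Ideal.Quotient.mk _ (X p (-(i p + j p))),
    Ideal.Quotient.mk _ (X p (j p))), ?_⟩
  have hclose : ∀ p q, ((i p, j p), Ideal.Quotient.mk (v.asIdeal ^ m) (X p (-(i p + j p))),
      Ideal.Quotient.mk v.asIdeal (X p (j p))) =
      ((i q, j q), Ideal.Quotient.mk (v.asIdeal ^ m) (X q (-(i q + j q))),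
      Ideal.Quotient.mk v.asIdeal (X q (j q))) → 2 * bil F (X p) (X q) ∈ v.asIdeal ^ (2 * m) := by
    intro p q hpq
    simp only [Prod.mk.injEq] at hpq
    obtain ⟨⟨h1, h2'⟩, h3, h4⟩ := hpq
    rw [← h1, ← h2'] at h3
    rw [← h2'] at h4
    have key := sub_mem_pow_of_smooth v hF (hX p) (hX q) (i p) (j p) (hij p) (m := m)
      (by
        have := Ideal.sub_mem _ (hc q) (hc p)
        rw [← h1] at this
        simpa [hXdef] using this)
      (Ideal.Quotient.eq.1 h3.symm) (Ideal.Quotient.eq.1 h4.symm)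
      (fun h => (hP.mem_or_mem h).elim h2 (hj p))
    have e1 : 2 * bil F (X p) (X q) = -∑ a, ∑ b, F a b * ((X q a - X p a) * (X q b - X p b)) := by
      have hp := hX p
      have hq := hX q
      simp only [bil, Fin.sum_univ_three] at hp hq ⊢
      rw [hF 1 0, hF 2 0, hF 2 1] at hp hq ⊢
      linear_combination hp + hq
    rw [e1, two_mul]
    exact neg_mem (Ideal.sum_mem _ fun a _ => Ideal.sum_mem _ fun b _ =>
      Ideal.mul_mem_left _ _ (mul_mem_pow_add (key a) (key b)))
  intro p q r hpq hqr
  have e2 : (4 * F.det) * det3 (X p) (X q) (X r) ^ 2 = (2 * bil F (X p) (X q)) *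
      ((2 * bil F (X p) (X r)) * (2 * bil F (X q) (X r))) := by
    linear_combination 4 * det_mul_det3_sq hF (hX p) (hX q) (hX r)
  have h6 : (4 * F.det) * det3 (X p) (X q) (X r) ^ 2 ∈ v.asIdeal ^ (2 * (3 * m)) := by
    rw [e2, show 2 * (3 * m) = 2 * m + (2 * m + 2 * m) by ring]
    exact mul_mem_pow_add (hclose _ _ hpq)
      (mul_mem_pow_add (hclose _ _ (hpq.trans hqr)) (hclose _ _ hqr))
  have h4 : (4 * F.det) ∉ v.asIdeal := by
    intro h
    have : (2 : R) * (2 * F.det) ∈ v.asIdeal := by convert h using 1; ring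
    exact (hP.mem_or_mem this).elim h2 hdet
  have h7 := sq_mem_pow_iff.1 (mem_pow_of_mul_mem h4 h6)
  have e3 : det3 (X p) (X q) (X r) = (c p * c q * c r) * det3 (x p) (x q) (x r) := by
    simp only [det3, hXdef]; ring
  rw [e3] at h7
  refine mem_pow_of_mul_mem (fun h => ?_) h7
  rcases hP.mem_or_mem h with h | h
  · exact (hP.mem_or_mem h).elim (hcv p) (hcv q)
  · exact hcv r h

end GoodPrime

section DivisorBound

/-- The absolute norm of an algebraic integer. -/
def absN (a : 𝓞 k) : ℕ := (Algebra.norm ℤ a).natAbs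

theorem absN_eq (a : 𝓞 k) : absN a = Ideal.absNorm (Ideal.span {a}) :=
  (Ideal.absNorm_span_singleton a).symm

theorem absN_mul (a b : 𝓞 k) : absN (a * b) = absN a * absN b := by
  simp [absN, Int.natAbs_mul]

theorem absN_pow (a : 𝓞 k) (n : ℕ) : absN (a ^ n) = absN a ^ n := by
  simp [absN, Int.natAbs_pow]

theorem one_le_absN {a : 𝓞 k} (ha : a ≠ 0) : 1 ≤ absN a := by
  rw [Nat.one_le_iff_ne_zero, absN, Int.natAbs_ne_zero]
  exact Algebra.norm_ne_zero_iff.2 ha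

/-- The order of vanishing of `a` at `v`, as a natural number. -/
def ordNat (v : HeightOneSpectrum (𝓞 k)) (a : 𝓞 k) : ℕ := (ordAt v a).toNat

theorem ordAt_eq_ordNat (v : HeightOneSpectrum (𝓞 k)) {a : 𝓞 k} (ha : a ≠ 0) :
    ordAt v a = ordNat v a :=
  (ENat.natCast_toNat (mt ordAt_eq_top.1 ha)).symm

theorem ordNat_ne_zero_iff {v : HeightOneSpectrum (𝓞 k)} {a : 𝓞 k} (ha : a ≠ 0) :
    ordNat v a ≠ 0 ↔ a ∈ v.asIdeal := by
  have h := le_ordAt (v := v) (a := a) (n := 1)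
  rw [ordAt_eq_ordNat v ha, pow_one, Nat.cast_le] at h
  rw [← h]
  omega

theorem finite_setOf_mem {a : 𝓞 k} (ha : a ≠ 0) :
    {v : HeightOneSpectrum (𝓞 k) | a ∈ v.asIdeal}.Finite := by
  have h := Ideal.finite_factors (I := Ideal.span {a}) (by simpa using ha)
  simpa [Ideal.dvd_span_singleton] using h

/-- The finite set of primes dividing a nonzero integer. -/
def primesOf {a : 𝓞 k} (ha : a ≠ 0) : Finset (HeightOneSpectrum (𝓞 k)) :=
  (finite_setOf_mem ha).toFinset

theorem mem_primesOf {a : 𝓞 k} (ha : a ≠ 0) {v : HeightOneSpectrum (𝓞 k)} :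
    v ∈ primesOf ha ↔ a ∈ v.asIdeal := by
  simp [primesOf]

/-- A divisor-type function: the number of divisors of the square. -/
def tauSq {a : 𝓞 k} (ha : a ≠ 0) : ℕ := ∏ v ∈ primesOf ha, (2 * ordNat v a + 1)

theorem isCoprime_pow_of_ne {v w : HeightOneSpectrum (𝓞 k)} (h : v ≠ w) (m n : ℕ) :
    IsCoprime (v.asIdeal ^ m) (w.asIdeal ^ n) := by
  have := v.isMaximal
  have := w.isMaximal
  exact IsCoprime.pow (Ideal.isCoprime_of_isMaximal fun h' => h (HeightOneSpectrum.ext h'))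

theorem prod_absNorm_pow_le {a : 𝓞 k} (ha : a ≠ 0) :
    ∏ v ∈ primesOf ha, Ideal.absNorm v.asIdeal ^ ordNat v a ≤ absN a := by
  have h : ∏ v ∈ primesOf ha, v.asIdeal ^ ordNat v a ∣ Ideal.span {a} := by
    apply Finset.prod_dvd_of_coprime
    · intro v _ w _ hvw
      exact isCoprime_pow_of_ne hvw _ _
    · intro v _
      rw [Ideal.dvd_span_singleton, ← le_ordAt, ordAt_eq_ordNat v ha]
  have h2 := Nat.le_of_dvd (by rw [← absN_eq]; exact one_le_absN ha) (map_dvd Ideal.absNorm h)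
  rw [map_prod] at h2
  simpa [absN_eq] using h2

theorem exists_linear_le_rpow {δ : ℝ} (hδ : 0 < δ) :
    ∃ C : ℝ, 1 ≤ C ∧ ∀ (e : ℕ) (q : ℝ), 2 ≤ q → 2 * (e : ℝ) + 1 ≤ C * (q ^ e) ^ δ := by
  have hl : 0 < Real.log 2 := Real.log_pos one_lt_two
  refine ⟨1 + 2 / (δ * Real.log 2), by have : 0 < 2 / (δ * Real.log 2) := by positivity
                                       linarith, fun e q hq => ?_⟩
  have h1 : 1 + e * δ * Real.log 2 ≤ ((2 : ℝ) ^ e) ^ δ := by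
    rw [← Real.rpow_natCast, ← Real.rpow_mul (by norm_num), Real.rpow_def_of_pos (by norm_num)]
    have := Real.add_one_le_exp (Real.log 2 * (e * δ))
    linarith
  have h2 : ((2 : ℝ) ^ e) ^ δ ≤ (q ^ e) ^ δ := by gcongr
  have h3 : 2 * (e : ℝ) + 1 ≤ (1 + 2 / (δ * Real.log 2)) * (1 + e * δ * Real.log 2) := by
    have : (1 + 2 / (δ * Real.log 2)) * (1 + e * δ * Real.log 2) =
        1 + e * δ * Real.log 2 + 2 / (δ * Real.log 2) + 2 * e := by field_simp; ring
    rw [this]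
    have : 0 ≤ e * δ * Real.log 2 := by positivity
    have : 0 ≤ 2 / (δ * Real.log 2) := by positivity
    linarith
  exact h3.trans (by gcongr; exact h1.trans h2)

theorem two_le_absNorm (v : HeightOneSpectrum (𝓞 k)) : (2 : ℝ) ≤ Ideal.absNorm v.asIdeal := by
  exact_mod_cast HeightOneSpectrum.one_lt_absNorm v

theorem finite_setOf_absNorm_rpow_lt {δ : ℝ} (hδ : 0 < δ) (B : ℝ) :
    {v : HeightOneSpectrum (𝓞 k) | (Ideal.absNorm v.asIdeal : ℝ) ^ δ < B}.Finite := by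
  have hfin := (Ideal.finite_setOfPred_absNorm_le (S := 𝓞 k) ⌈|B| ^ (1 / δ)⌉₊).preimage
    (HeightOneSpectrum.asIdeal_injective (R := 𝓞 k)).injOn
  refine hfin.subset fun v hv => ?_
  simp only [Set.mem_ofPred_eq] at hv
  simp only [Set.mem_preimage, Set.mem_ofPred_eq]
  have h0 : (0 : ℝ) ≤ Ideal.absNorm v.asIdeal := by positivity
  have h1 : (Ideal.absNorm v.asIdeal : ℝ) ≤ |B| ^ (1 / δ) := by
    calc (Ideal.absNorm v.asIdeal : ℝ) = ((Ideal.absNorm v.asIdeal : ℝ) ^ δ) ^ (1 / δ) := by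
          rw [← Real.rpow_mul h0, mul_one_div_cancel hδ.ne', Real.rpow_one]
      _ ≤ _ := by
          apply Real.rpow_le_rpow (by positivity) (hv.le.trans (le_abs_self B)) (by positivity)
  exact_mod_cast h1.trans (Nat.le_ceil _)

variable (k) in
theorem exists_tauSq_le {δ : ℝ} (hδ : 0 < δ) :
    ∃ C : ℝ, 1 ≤ C ∧ ∀ (a : 𝓞 k) (ha : a ≠ 0), (tauSq ha : ℝ) ≤ C * (absN a : ℝ) ^ δ := by
  classical
  obtain ⟨C0, hC0, hlin⟩ := exists_linear_le_rpow hδ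
  set W := (finite_setOf_absNorm_rpow_lt (k := k) hδ 3).toFinset with hW
  refine ⟨C0 ^ W.card, one_le_pow₀ hC0, fun a ha => ?_⟩
  have hfac : ∀ v ∈ primesOf ha, ((2 * ordNat v a + 1 : ℕ) : ℝ) ≤
      (if v ∈ W then C0 else 1) * ((Ideal.absNorm v.asIdeal : ℝ) ^ ordNat v a) ^ δ := by
    intro v _
    push_cast
    split_ifs with hv
    · exact hlin _ _ (two_le_absNorm v)
    · have h3 : (3 : ℝ) ≤ (Ideal.absNorm v.asIdeal : ℝ) ^ δ := by
        simpa [hW] using hv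
      have h0 : (0 : ℝ) ≤ Ideal.absNorm v.asIdeal := by positivity
      rw [one_mul, ← Real.rpow_natCast, ← Real.rpow_mul h0, mul_comm _ δ, Real.rpow_mul h0,
        Real.rpow_natCast]
      have hb := one_add_mul_le_pow (a := (2 : ℝ)) (by norm_num) (ordNat v a)
      calc 2 * (ordNat v a : ℝ) + 1 ≤ (1 + 2) ^ ordNat v a := by linarith
        _ ≤ _ := by
          have : (1 + 2 : ℝ) ≤ (Ideal.absNorm v.asIdeal : ℝ) ^ δ := by linarith
          gcongr
  have hprod : ∏ v ∈ primesOf ha, (if v ∈ W then C0 else 1) ≤ C0 ^ W.card := by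
    rw [Finset.prod_ite, Finset.prod_const, Finset.prod_const_one, mul_one]
    apply pow_le_pow_right₀ hC0
    apply Finset.card_le_card
    intro v hv
    exact (Finset.mem_filter.1 hv).2
  calc (tauSq ha : ℝ) = ∏ v ∈ primesOf ha, ((2 * ordNat v a + 1 : ℕ) : ℝ) := by
        rw [tauSq, Nat.cast_prod]
    _ ≤ ∏ v ∈ primesOf ha,
        ((if v ∈ W then C0 else 1) * ((Ideal.absNorm v.asIdeal : ℝ) ^ ordNat v a) ^ δ) :=
        Finset.prod_le_prod (fun v _ => by positivity) hfac
    _ = (∏ v ∈ primesOf ha, (if v ∈ W then C0 else 1)) *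
        (∏ v ∈ primesOf ha, (Ideal.absNorm v.asIdeal : ℝ) ^ ordNat v a) ^ δ := by
        rw [Finset.prod_mul_distrib, Real.finsetProd_rpow _ _ (fun v _ => by positivity)]
    _ ≤ _ := by
        gcongr
        exact_mod_cast prod_absNorm_pow_le ha

theorem exists_prime_above {p : ℕ} (hp : p.Prime) :
    ∃ v : HeightOneSpectrum (𝓞 k), ((p : ℕ) : 𝓞 k) ∈ v.asIdeal ∧
      Ideal.absNorm v.asIdeal ≤ p ^ Module.finrank ℚ k := by
  have hN : absN ((p : ℕ) : 𝓞 k) = p ^ Module.finrank ℚ k := by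
    have h := Algebra.norm_algebraMap (R := ℤ) (S := 𝓞 k) (p : ℤ)
    rw [RingOfIntegers.rank] at h
    have h2 : algebraMap ℤ (𝓞 k) (p : ℤ) = ((p : ℕ) : 𝓞 k) := by simp
    rw [absN, ← h2, h, Int.natAbs_pow, Int.natAbs_natCast]
  have hp0 : ((p : ℕ) : 𝓞 k) ≠ 0 := by exact_mod_cast hp.ne_zero
  have htop : Ideal.span {((p : ℕ) : 𝓞 k)} ≠ ⊤ := by
    intro h
    have h1 := absN_eq ((p : ℕ) : 𝓞 k)
    rw [h, hN, Ideal.absNorm_top] at h1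
    have h2 : 0 < Module.finrank ℚ k := Module.finrank_pos
    exact absurd h1 (Nat.one_lt_pow h2.ne' hp.one_lt).ne'
  obtain ⟨M, hM, hle⟩ := Ideal.exists_le_maximal _ htop
  have hmem : ((p : ℕ) : 𝓞 k) ∈ M := hle (Ideal.mem_span_singleton_self _)
  refine ⟨⟨M, hM.isPrime, fun h => hp0 (by simpa [h] using hmem)⟩, hmem, ?_⟩
  rw [← hN, absN_eq]
  exact Nat.le_of_dvd (by rw [← absN_eq]; exact one_le_absN hp0)
    (Ideal.absNorm_dvd_absNorm_of_le hle)

/-- There is a prime of small norm not dividing a given integer. -/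
theorem exists_notMem_absNorm_le {a : 𝓞 k} (ha : a ≠ 0) :
    ∃ v : HeightOneSpectrum (𝓞 k), a ∉ v.asIdeal ∧
      Ideal.absNorm v.asIdeal ≤ (2 * tauSq ha) ^ Module.finrank ℚ k := by
  classical
  choose p hp hlt hle using fun i : ℕ =>
    Nat.exists_prime_lt_and_le_two_mul (2 ^ i) (by positivity)
  choose v hv hvN using fun i => exists_prime_above (k := k) (hp i)
  have hpinj : ∀ i j, i < j → p i < p j := by
    intro i j hij
    calc p i ≤ 2 * 2 ^ i := hle i
      _ = 2 ^ (i + 1) := by ring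
      _ ≤ 2 ^ j := Nat.pow_le_pow_right (by norm_num) hij
      _ < p j := hlt j
  have hvne : ∀ i j, i < j → v i ≠ v j := by
    intro i j hij h
    have hcop : Nat.Coprime (p i) (p j) :=
      (Nat.coprime_primes (hp i) (hp j)).2 (hpinj i j hij).ne
    have hc := (Nat.isCoprime_iff_coprime.2 hcop).map (Int.castRingHom (𝓞 k))
    obtain ⟨x, y, hxy⟩ := hc
    simp only [eq_intCast, Int.cast_natCast] at hxy
    apply (v j).isPrime.ne_top
    rw [Ideal.eq_top_iff_one, ← hxy]
    exact Ideal.add_mem _ (Ideal.mul_mem_left _ _ (h ▸ hv i)) (Ideal.mul_mem_left _ _ (hv j))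
  have hvinj : Function.Injective v := by
    intro i j h
    rcases lt_trichotomy i j with hij | hij | hij
    · exact absurd h (hvne _ _ hij)
    · exact hij
    · exact absurd h.symm (hvne _ _ hij)
  set j := Nat.log 2 (tauSq ha) + 1 with hj
  have htau : tauSq ha ≠ 0 := Finset.prod_ne_zero_iff.2 fun v _ => by omega
  have hcon : ∃ i < j, a ∉ (v i).asIdeal := by
    by_contra! hall
    have hsub : (Finset.range j).image v ⊆ primesOf ha := by
      intro w hw
      obtain ⟨i, hi, rfl⟩ := Finset.mem_image.1 hw
      exact (mem_primesOf ha).2 (hall i (Finset.mem_range.1 hi))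
    have hcard := Finset.card_le_card hsub
    rw [Finset.card_image_of_injective _ hvinj, Finset.card_range] at hcard
    have h2 : 2 ^ (primesOf ha).card ≤ tauSq ha := by
      rw [tauSq]
      apply Finset.pow_card_le_prod
      intro w hw
      have := (ordNat_ne_zero_iff ha).2 ((mem_primesOf ha).1 hw)
      omega
    have h3 : 2 ^ j ≤ tauSq ha := (Nat.pow_le_pow_right (by norm_num) hcard).trans h2
    exact absurd h3 (Nat.lt_pow_succ_log_self (by norm_num) _).not_ge
  obtain ⟨i, hi, hai⟩ := hcon
  refine ⟨v i, hai, (hvN i).trans (Nat.pow_le_pow_left ?_ _)⟩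
  calc p i ≤ 2 * 2 ^ i := hle i
    _ ≤ 2 * 2 ^ Nat.log 2 (tauSq ha) := by
      gcongr
      · norm_num
      · omega
    _ ≤ 2 * tauSq ha := by
      gcongr
      exact Nat.pow_log_le_self 2 htau

variable (k) in
theorem exists_prime_absNorm_le {δ : ℝ} (hδ : 0 < δ) :
    ∃ C : ℝ, 1 ≤ C ∧ ∀ a : 𝓞 k, a ≠ 0 → ∃ v : HeightOneSpectrum (𝓞 k), a ∉ v.asIdeal ∧
      (Ideal.absNorm v.asIdeal : ℝ) ≤ C * (absN a : ℝ) ^ δ := by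
  set d := Module.finrank ℚ k with hd
  have hdpos : 0 < d := Module.finrank_pos
  have hdR : (0 : ℝ) < d := by exact_mod_cast hdpos
  obtain ⟨C, hC, htau⟩ := exists_tauSq_le k (δ := δ / d) (by positivity)
  refine ⟨(2 * C) ^ d, one_le_pow₀ (by linarith), fun a ha => ?_⟩
  obtain ⟨v, hv, hN⟩ := exists_notMem_absNorm_le ha
  refine ⟨v, hv, ?_⟩
  calc (Ideal.absNorm v.asIdeal : ℝ) ≤ (2 * (tauSq ha : ℝ)) ^ d := by exact_mod_cast hN
    _ ≤ (2 * (C * (absN a : ℝ) ^ (δ / d))) ^ d := by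
      gcongr
      exact htau a ha
    _ = (2 * C) ^ d * (absN a : ℝ) ^ δ := by
      rw [← mul_assoc, mul_pow, ← Real.rpow_natCast (_ ^ (δ / d)), ← Real.rpow_mul (by positivity),
        div_mul_cancel₀ _ hdR.ne']

end DivisorBound

section Classes

theorem card_classes {v : HeightOneSpectrum (𝓞 k)} (m : ℕ) :
    Finite (𝓞 k ⧸ v.asIdeal ^ m) ∧
      Nat.card (𝓞 k ⧸ v.asIdeal ^ m) = Ideal.absNorm v.asIdeal ^ m := by
  refine ⟨Ideal.finiteQuotientOfFreeOfNeBot _ (pow_ne_zero m v.ne_bot), ?_⟩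
  rw [← map_pow, Ideal.absNorm_apply, Submodule.cardQuot_apply]

theorem exists_classes {F : Matrix (Fin 3) (Fin 3) (𝓞 k)} (hF : ∀ i j, F i j = F j i)
    (hdet : F.det ≠ 0) {β : 𝓞 k}
    (hβ : ∀ v : HeightOneSpectrum (𝓞 k), ∃ P : Matrix (Fin 3) (Fin 3) (𝓞 k),
      ordAt v (pivot P F) ≤ ordAt v β)
    (v₀ : HeightOneSpectrum (𝓞 k)) (hv₀ : 2 * F.det ∉ v₀.asIdeal) {m : ℕ} (hm : m ≠ 0)
    {T : Type} (x : T → Fin 3 → 𝓞 k) (hx : ∀ p, bil F (x p) (x p) = 0)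
    (hprim : ∀ p, ∃ i, x p i ∉ v₀.asIdeal) :
    ∃ (κ : Type) (cl : T → κ), Finite κ ∧
      Nat.card κ = tauSq hdet * (9 * (Ideal.absNorm v₀.asIdeal ^ m * Ideal.absNorm v₀.asIdeal)) ∧
      ∀ p q r, cl p = cl q → cl q = cl r →
        Ideal.span {F.det} ^ 2 * v₀.asIdeal ^ (6 * m) ∣
          Ideal.span {4 * β ^ 3 * det3 (x p) (x q) (x r) ^ 2} := by
  classical
  choose P hP using hβ
  choose clb hclb using fun v : HeightOneSpectrum (𝓞 k) =>
    exists_classes_bad v hF (ordAt_eq_ordNat v hdet) (hP v) x hx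
  obtain ⟨clg, hclg⟩ := exists_classes_good v₀ hF hv₀ hm x hx hprim
  obtain ⟨hfin1, hc1⟩ := card_classes (v := v₀) m
  obtain ⟨hfin2, hc2⟩ := card_classes (v := v₀) 1
  rw [pow_one] at hfin2 hc2
  refine ⟨(∀ v : primesOf hdet, Fin (2 * ordNat v.1 F.det + 1)) ×
    ((Fin 3 × Fin 3) × (𝓞 k ⧸ v₀.asIdeal ^ m) × (𝓞 k ⧸ v₀.asIdeal)),
    fun p => (fun v => clb v.1 p, clg p), inferInstance, ?_, ?_⟩
  · rw [Nat.card_prod, Nat.card_prod, Nat.card_prod, Nat.card_prod, hc1, hc2, Nat.card_pi, tauSq]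
    congr 1
    · simpa using Finset.prod_coe_sort (primesOf hdet) fun v => 2 * ordNat v F.det + 1
    · simp
  · intro p q r hpq hqr
    have hpow : Ideal.span {F.det} ^ 2 ≠ 0 := pow_ne_zero _ (by simpa using hdet)
    refine IsCoprime.mul_dvd ?_ ?_ ?_
    · refine IsCoprime.pow ?_
      have := v₀.isMaximal
      rw [Ideal.isCoprime_iff_sup_eq, sup_comm]
      refine this.out.2 _ (left_lt_sup.2 fun h => hv₀ ?_)
      exact Ideal.mul_mem_left _ _ (h (Ideal.mem_span_singleton_self _))
    · rw [UniqueFactorizationMonoid.dvd_iff_emultiplicity_le hpow]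
      intro 𝔭 h𝔭
      let v : HeightOneSpectrum (𝓞 k) := ⟨𝔭, Ideal.isPrime_of_prime h𝔭, h𝔭.ne_zero⟩
      have h1 : emultiplicity 𝔭 (Ideal.span {F.det} ^ 2) = ((2 * ordNat v F.det : ℕ) : ℕ∞) := by
        rw [emultiplicity_pow h𝔭]
        change _ * ordAt v F.det = _
        rw [ordAt_eq_ordNat v hdet]
        push_cast; rfl
      rw [h1, ← pow_dvd_iff_le_emultiplicity, Ideal.dvd_span_singleton]
      by_cases hv : F.det ∈ v.asIdeal
      · have h2 := congrFun (congrArg Prod.fst hpq) ⟨v, (mem_primesOf hdet).2 hv⟩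
        have h3 := congrFun (congrArg Prod.fst hqr) ⟨v, (mem_primesOf hdet).2 hv⟩
        exact hclb v p q r h2 h3
      · have : ordNat v F.det = 0 := by
          by_contra h
          exact hv ((ordNat_ne_zero_iff hdet).1 h)
        rw [this]
        simp
    · rw [Ideal.dvd_span_singleton]
      have h := hclg p q r (congrArg Prod.snd hpq) (congrArg Prod.snd hqr)
      refine Ideal.mul_mem_left _ _ ?_
      have h2 := Ideal.pow_mem_pow h 2
      rw [← pow_mul] at h2
      convert h2 using 2
      ring

/-- Solutions of a nondegenerate ternary quadratic equation with small determinants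
lie in few classes, each of which contains at most two of them. -/
theorem card_solutions_le {F : Matrix (Fin 3) (Fin 3) (𝓞 k)} (hF : ∀ i j, F i j = F j i)
    (hdet : F.det ≠ 0) {β : 𝓞 k} (hβ0 : β ≠ 0)
    (hβ : ∀ v : HeightOneSpectrum (𝓞 k), ∃ P : Matrix (Fin 3) (Fin 3) (𝓞 k),
      ordAt v (pivot P F) ≤ ordAt v β)
    (v₀ : HeightOneSpectrum (𝓞 k)) (hv₀ : 2 * F.det ∉ v₀.asIdeal) {m : ℕ} (hm : m ≠ 0)
    {T : Type} (x : T → Fin 3 → 𝓞 k) (hx : ∀ p, bil F (x p) (x p) = 0)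
    (hprim : ∀ p, ∃ i, x p i ∉ v₀.asIdeal)
    (hinj : ∀ p q, (∀ i j, x p i * x q j = x p j * x q i) → p = q)
    (hsmall : ∀ p q r, absN (4 * β ^ 3) * absN (det3 (x p) (x q) (x r)) ^ 2 <
      absN F.det ^ 2 * Ideal.absNorm v₀.asIdeal ^ (6 * m)) :
    Nat.card T ≤
      2 * (tauSq hdet * (9 * (Ideal.absNorm v₀.asIdeal ^ m * Ideal.absNorm v₀.asIdeal))) := by
  classical
  obtain ⟨κ, cl, hfin, hcard, hdvd⟩ := exists_classes hF hdet hβ v₀ hv₀ hm x hx hprim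
  rcases finite_or_infinite T with hT | hT
  swap
  · simp
  rw [← hcard]
  have := Fintype.ofFinite T
  have := Fintype.ofFinite κ
  rw [Nat.card_eq_fintype_card, Nat.card_eq_fintype_card]
  have hD : ∀ p q r, cl p = cl q → cl q = cl r → det3 (x p) (x q) (x r) = 0 := by
    intro p q r hpq hqr
    by_contra h0
    have h4 : (4 : 𝓞 k) ≠ 0 := by norm_num
    have hne : 4 * β ^ 3 * det3 (x p) (x q) (x r) ^ 2 ≠ 0 :=
      mul_ne_zero (mul_ne_zero h4 (pow_ne_zero _ hβ0)) (pow_ne_zero _ h0)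
    have h1 := Nat.le_of_dvd (by rw [← absN_eq]; exact one_le_absN hne)
      (map_dvd Ideal.absNorm (hdvd p q r hpq hqr))
    rw [map_mul, map_pow, map_pow, ← absN_eq, ← absN_eq, absN_mul _ (det3 _ _ _ ^ 2),
      absN_pow _ 2] at h1
    exact absurd h1 (not_le.2 (hsmall p q r))
  have h := Finset.card_le_mul_card_image (f := cl) (Finset.univ : Finset T) 2 (by
    intro c _
    by_contra! hlt
    obtain ⟨p, hp, q, hq, r, hr, hpq, hpr, hqr⟩ := Finset.two_lt_card.1 hlt
    simp only [Finset.mem_filter, Finset.mem_univ, true_and] at hp hq hr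
    have h0 := det_mul_det3_sq hF (hx p) (hx q) (hx r)
    rw [hD p q r (hp.trans hq.symm) (hq.trans hr.symm)] at h0
    have h00 : 2 * bil F (x p) (x q) * bil F (x p) (x r) * bil F (x q) (x r) = 0 := by
      rw [← h0]; ring
    have key : ∀ s t, s ≠ t → bil F (x s) (x t) ≠ 0 := by
      intro s t hst h
      exact hst (hinj s t (cross_eq_zero_of_isotropic hF hdet (hx s) (hx t) h))
    have h2 : (2 : 𝓞 k) ≠ 0 := by norm_num
    exact mul_ne_zero (mul_ne_zero (mul_ne_zero h2 (key p q hpq)) (key p r hpr)) (key q r hqr) h00)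
  refine h.trans ?_
  gcongr
  exact Finset.card_le_univ _

end Classes

section RankOne

theorem map_pivot {R S : Type*} [CommRing R] [CommRing S] (φ : R →+* S)
    (P F : Matrix (Fin 3) (Fin 3) R) : φ (pivot P F) = pivot (P.map φ) (F.map φ) := by
  simp [pivot, bil, Matrix.det_fin_three, Fin.sum_univ_three]

variable {K : Type*} [Field K] [CharZero K] {F : Matrix (Fin 3) (Fin 3) K}

/-- A totally degenerate plane: all bases of it extended to `K³` have vanishing pivot. -/
theorem gram_eq_zero_of_pivot_eq_zero (hF : ∀ i j, F i j = F j i)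
    (h : ∀ P : Matrix (Fin 3) (Fin 3) ℤ, pivot (P.map (Int.castRingHom K)) F = 0)
    (u v w : Fin 3 → ℤ) (hd : det3 u v w ≠ 0) :
    bil F (fun i => (u i : K)) (fun i => (u i : K)) * bil F (fun i => (v i : K)) (fun i => (v i : K))
      - bil F (fun i => (u i : K)) (fun i => (v i : K)) ^ 2 = 0 := by
  by_contra hG
  have key : ∀ u' v' : Fin 3 → ℤ, (Matrix.of ![u', v', w]).det ^ 2 = det3 u v w ^ 2 →
      bil F (fun i => (u' i : K)) (fun i => (u' i : K)) *
        bil F (fun i => (v' i : K)) (fun i => (v' i : K))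
      - bil F (fun i => (u' i : K)) (fun i => (v' i : K)) ^ 2 ≠ 0 →
      bil F (fun i => (u' i : K)) (fun i => (u' i : K)) = 0 := by
    intro u' v' h1 h2
    have h3 := h (Matrix.of ![u', v', w])
    have h4 : ((Matrix.of ![u', v', w]).map (Int.castRingHom K)).det ^ 2 ≠ 0 := by
      have : ((Matrix.of ![u', v', w]).map (Int.castRingHom K)).det =
          (((Matrix.of ![u', v', w]).det : ℤ) : K) := by
        have := (RingHom.map_det (Int.castRingHom K) (Matrix.of ![u', v', w]))
        rw [RingHom.mapMatrix_apply] at this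
        exact this.symm
      rw [this, ← Int.cast_pow, h1]
      exact_mod_cast pow_ne_zero 2 hd
    rw [pivot, mul_eq_zero, mul_eq_zero, or_iff_left h4] at h3
    exact h3.resolve_right h2
  have h1 := key u v (by simp [Matrix.det_fin_three, det3]; ring) hG
  have h2 := key v u (by simp [Matrix.det_fin_three, det3]; ring)
    (by rw [bil_comm hF (fun i => (v i : K)) (fun i => (u i : K))]; contrapose! hG; rw [← hG]; ring)
  have hadd : bil F (fun i => ((u + v) i : ℤ) : Fin 3 → K) (fun i => ((u + v) i : ℤ)) =
      bil F (fun i => (u i : K)) (fun i => (u i : K)) + bil F (fun i => (v i : K)) (fun i => (v i : K))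
      + 2 * bil F (fun i => (u i : K)) (fun i => (v i : K)) := by
    simp only [bil, Fin.sum_univ_three, Pi.add_apply, Int.cast_add]
    rw [hF 1 0, hF 2 0, hF 2 1]
    ring
  have hadd2 : bil F (fun i => ((u + v) i : ℤ) : Fin 3 → K) (fun i => (v i : K)) =
      bil F (fun i => (u i : K)) (fun i => (v i : K)) +
        bil F (fun i => (v i : K)) (fun i => (v i : K)) := by
    simp only [bil, Fin.sum_univ_three, Pi.add_apply, Int.cast_add]
    ring
  have h3 := key (u + v) v (by simp [Matrix.det_fin_three, det3]; ring)
    (by rw [hadd, hadd2]; contrapose! hG; rw [← hG]; ring)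
  rw [hadd, h1, h2] at h3
  have h4 : bil F (fun i => (u i : K)) (fun i => (v i : K)) = 0 := by
    have : (2 : K) ≠ 0 := two_ne_zero
    simpa [this] using h3
  apply hG
  rw [h1, h2, h4]
  ring

theorem minors_eq_zero_of_pivot_eq_zero (hF : ∀ i j, F i j = F j i)
    (h : ∀ P : Matrix (Fin 3) (Fin 3) ℤ, pivot (P.map (Int.castRingHom K)) F = 0)
    (i j p q : Fin 3) : F i j * F p q = F i q * F p j := by
  have g := gram_eq_zero_of_pivot_eq_zero hF h
  have h2 : (2 : K) ≠ 0 := two_ne_zero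
  have g0 := g ![0, 1, 0] ![0, 0, 1] ![1, 0, 0] (by simp [det3])
  have g1 := g ![1, 0, 0] ![0, 0, 1] ![0, 1, 0] (by simp [det3])
  have g2 := g ![1, 0, 0] ![0, 1, 0] ![0, 0, 1] (by simp [det3])
  have g3 := g ![1, -1, 0] ![0, 0, 1] ![0, 1, 0] (by simp [det3])
  have g4 := g ![1, 0, -1] ![0, 1, 0] ![0, 0, 1] (by simp [det3])
  have g5 := g ![0, 1, -1] ![1, 0, 0] ![0, 0, 1] (by simp [det3])
  have e1 := hF 1 0
  have e2 := hF 2 0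
  have e3 := hF 2 1
  simp [bil, Fin.sum_univ_three, e1, e2, e3] at g0 g1 g2 g3 g4 g5
  have t1 : F 0 1 * F 2 2 = F 0 2 * F 1 2 := by
    apply mul_left_cancel₀ h2; linear_combination -g3 + g0 + g1
  have t2 : F 0 2 * F 1 1 = F 0 1 * F 1 2 := by
    apply mul_left_cancel₀ h2; linear_combination -g4 + g0 + g2
  have t3 : F 1 2 * F 0 0 = F 0 1 * F 0 2 := by
    apply mul_left_cancel₀ h2; linear_combination -g5 + g1 + g2
  fin_cases i <;> fin_cases j <;> fin_cases p <;> fin_cases q <;>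
    simp only [Fin.zero_eta, Fin.mk_one, Fin.reduceFinMk, e1, e2, e3] <;>
    grind

/-- A form of rank at most one contains in its kernel the kernel of a linear form. -/
theorem exists_linear_of_minors (hmin : ∀ i j p q, F i j * F p q = F i q * F p j) :
    ∃ r : Fin 3 → K, r ≠ 0 ∧ ∀ x : Fin 3 → K, ∑ j, r j * x j = 0 → ∀ i, ∑ j, F i j * x j = 0 := by
  by_cases h0 : F = 0
  · exact ⟨fun _ => 1, fun h => one_ne_zero (congrFun h 0), fun x _ i => by simp [h0]⟩
  · obtain ⟨i₀, hi₀⟩ : ∃ i, F i ≠ 0 := by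
      by_contra! h
      exact h0 (funext h)
    refine ⟨F i₀, hi₀, fun x hx i => ?_⟩
    obtain ⟨l, hl⟩ := Function.ne_iff.1 hi₀
    apply mul_left_cancel₀ hl
    rw [mul_zero, Finset.mul_sum]
    calc ∑ j, F i₀ l * (F i j * x j) = ∑ j, F i l * (F i₀ j * x j) := by
          refine Finset.sum_congr rfl fun j _ => ?_
          linear_combination x j * hmin i₀ l i j
      _ = 0 := by rw [← Finset.mul_sum, hx, mul_zero]

/-- On the kernel of a linear form in three variables, a quadratic form has a nontrivial zero. -/
theorem exists_isotropic_of_linear [IsAlgClosed K] (r : Fin 3 → K) (hr : r ≠ 0)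
    {G : Matrix (Fin 3) (Fin 3) K} (hG : ∀ i j, G i j = G j i) :
    ∃ x : Fin 3 → K, x ≠ 0 ∧ ∑ j, r j * x j = 0 ∧ bil G x x = 0 := by
  obtain ⟨u, v, hu, hv, hind⟩ : ∃ u v : Fin 3 → K, ∑ j, r j * u j = 0 ∧ ∑ j, r j * v j = 0 ∧
      ∀ s t : K, s • u + t • v = 0 → s = 0 ∧ t = 0 := by
    obtain ⟨l, hl⟩ := Function.ne_iff.1 hr
    simp only [Pi.zero_apply] at hl
    fin_cases l
    · refine ⟨![-r 1, r 0, 0], ![-r 2, 0, r 0], by simp [Fin.sum_univ_three]; ring,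
        by simp [Fin.sum_univ_three]; ring, fun s t h => ?_⟩
      have h1 := congrFun h 1
      have h2 := congrFun h 2
      simp at h1 h2 hl
      simp_all
    · refine ⟨![r 1, -r 0, 0], ![0, -r 2, r 1], by simp [Fin.sum_univ_three]; ring,
        by simp [Fin.sum_univ_three]; ring, fun s t h => ?_⟩
      have h1 := congrFun h 0
      have h2 := congrFun h 2
      simp at h1 h2 hl
      simp_all
    · refine ⟨![r 2, 0, -r 0], ![0, r 2, -r 1], by simp [Fin.sum_univ_three]; ring,
        by simp [Fin.sum_univ_three]; ring, fun s t h => ?_⟩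
      have h1 := congrFun h 0
      have h2 := congrFun h 1
      simp at h1 h2 hl
      simp_all
  by_cases h0 : bil G u u = 0
  · refine ⟨u, ?_, hu, h0⟩
    rintro rfl
    have := (hind 1 0 (by simp)).1
    exact one_ne_zero this
  · obtain ⟨s, hs⟩ := exists_quadratic_eq_zero (a := bil G u u) (b := 2 * bil G u v)
      (c := bil G v v) h0 (by
        obtain ⟨z, hz⟩ := IsAlgClosed.exists_eq_mul_self
          (discrim (bil G u u) (2 * bil G u v) (bil G v v))
        exact ⟨z, hz⟩)
    refine ⟨s • u + (1 : K) • v, fun h => one_ne_zero (hind s 1 h).2, ?_, ?_⟩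
    · simp only [Fin.sum_univ_three, Pi.add_apply, Pi.smul_apply, smul_eq_mul] at hu hv ⊢
      linear_combination s * hu + hv
    · rw [← hs]
      simp only [bil, Fin.sum_univ_three, Pi.add_apply, Pi.smul_apply, smul_eq_mul]
      rw [hG 1 0, hG 2 0, hG 2 1]
      ring

end RankOne

section Smoothness

theorem bil_eq_zero_of_mulVec {R : Type*} [CommRing R] {F : Matrix (Fin 3) (Fin 3) R}
    {x : Fin 3 → R} (hx : ∀ i, ∑ j, F i j * x j = 0) : bil F x x = 0 := by
  have h : bil F x x = ∑ i, x i * ∑ j, F i j * x j := by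
    simp only [bil, Finset.mul_sum]
    exact Finset.sum_congr rfl fun i _ => Finset.sum_congr rfl fun j _ => by ring
  simp [h, hx]

variable {f : Fin 3 → Fin 3 → MvPolynomial (Fin (1 + 1)) (𝓞 k)}

theorem aeval_map_algebraMap' {σ : Type*} (y : σ → AlgebraicClosure k)
    (p : MvPolynomial σ (𝓞 k)) : aeval y (map (algebraMap (𝓞 k) k) p) = aeval y p := by
  rw [MvPolynomial.aeval_map_algebraMap]

theorem aeval_Qk (y : Fin (1 + 1) → AlgebraicClosure k) (x : Fin 3 → AlgebraicClosure k) :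
    aeval (Sum.elim y x) (Qk f) = bil (Matrix.of fun i j => aeval y (f i j)) x x := by
  simp [Qk, bil, aeval_rename, Function.comp_def, aeval_map_algebraMap']

theorem aeval_pderiv_inl (y : Fin (1 + 1) → AlgebraicClosure k)
    (x : Fin 3 → AlgebraicClosure k) (s : Fin (1 + 1)) :
    aeval (Sum.elim y x) (pderiv (Sum.inl s) (Qk f)) =
      bil (Matrix.of fun i j => aeval y (pderiv s (f i j))) x x := by
  simp [Qk, bil, pderiv_rename Sum.inl_injective, pderiv_map, Derivation.leibniz, pderiv_X,
    aeval_rename, Function.comp_def, aeval_map_algebraMap', Fin.sum_univ_three]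
  ring

theorem aeval_pderiv_inr (hf : ∀ i j, f i j = f j i) (y : Fin (1 + 1) → AlgebraicClosure k)
    (x : Fin 3 → AlgebraicClosure k) (s : Fin 3) :
    aeval (Sum.elim y x) (pderiv (Sum.inr s) (Qk f)) =
      2 * ∑ j, aeval y (f s j) * x j := by
  have h0 : ∀ p : MvPolynomial (Fin (1 + 1)) k,
      pderiv (Sum.inr s) (rename (Sum.inl : Fin (1 + 1) → Fin (1 + 1) ⊕ Fin 3) p) = 0 := by
    intro p
    apply pderiv_eq_zero_of_notMem_vars
    intro h
    classical
    obtain ⟨i, _, hi⟩ := Finset.mem_image.1 (vars_rename _ _ h)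
    simp at hi
  simp only [Qk, map_sum, Derivation.leibniz, h0, smul_eq_mul, pderiv_X]
  rw [show (2 : AlgebraicClosure k) * ∑ j, aeval y (f s j) * x j =
    ∑ j, aeval y (f s j) * x j + ∑ j, aeval y (f j s) * x j by
      simp_rw [hf _ s]; ring]
  fin_cases s <;>
  simp [aeval_rename, Function.comp_def, aeval_map_algebraMap', Fin.sum_univ_three, Pi.single_apply]
    <;> ring

/-- Smoothness implies that the conics in the family have rank at least two. -/
theorem eq_zero_of_pivots {a : Fin 3 → ℤ} {e : ℤ} (hf : DegOK a e f) (hs : IsSmoothX f)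
    (y : Fin (1 + 1) → AlgebraicClosure k)
    (h : ∀ P : Matrix (Fin 3) (Fin 3) ℤ, pivot (P.map (Int.castRingHom (AlgebraicClosure k)))
      (Matrix.of fun i j => aeval y (f i j)) = 0) : y = 0 := by
  by_contra hy
  set F : Matrix (Fin 3) (Fin 3) (AlgebraicClosure k) := Matrix.of fun i j => aeval y (f i j)
    with hFdef
  have hFs : ∀ i j, F i j = F j i := fun i j => by simp [hFdef, (hf i j).1]
  obtain ⟨r, hr, hker⟩ := exists_linear_of_minors (minors_eq_zero_of_pivot_eq_zero hFs h)
  set G : Fin (1 + 1) → Matrix (Fin 3) (Fin 3) (AlgebraicClosure k) :=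
    fun s => Matrix.of fun i j => aeval y (pderiv s (f i j)) with hGdef
  have hGs : ∀ s i j, G s i j = G s j i := fun s i j => by simp [hGdef, (hf i j).1]
  have heuler : ∀ i j, y 0 * G 0 i j + y 1 * G 1 i j =
      ((a i : AlgebraicClosure k) + a j + e) * F i j := by
    intro i j
    rcases lt_or_ge (a i + a j + e) 0 with hneg | hpos
    · simp [hGdef, hFdef, (hf i j).2.2 hneg]
    · have h1 := congrArg (aeval y) (hf i j).2.1.sum_X_mul_pderiv
      have h2 : (((a i + a j + e).toNat : ℕ) : AlgebraicClosure k) =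
          (a i : AlgebraicClosure k) + a j + e := by
        have h3 : (((a i + a j + e).toNat : ℤ) : AlgebraicClosure k) =
          ((a i + a j + e : ℤ) : AlgebraicClosure k) := by rw [Int.toNat_of_nonneg hpos]
        push_cast at h3
        exact h3
      simp only [map_sum, map_mul, aeval_X, nsmul_eq_mul, map_natCast, h2] at h1
      rw [← Fin.sum_univ_two (f := fun s => y s * G s i j)]
      exact h1
  have hsum : ∀ x : Fin 3 → AlgebraicClosure k, (∀ i, ∑ j, F i j * x j = 0) →
      y 0 * bil (G 0) x x + y 1 * bil (G 1) x x = 0 := by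
    intro x hx
    have e0 := hx 0
    have e1 := hx 1
    have e2 := hx 2
    simp only [Fin.sum_univ_three] at e0 e1 e2
    have s1 := hFs 1 0
    have s2 := hFs 2 0
    have s3 := hFs 2 1
    simp only [bil, Fin.sum_univ_three]
    rw [s1] at e1
    rw [s2, s3] at e2
    have E : ∀ i j, y 0 * G 0 i j = ((a i : AlgebraicClosure k) + a j + e) * F i j
      - y 1 * G 1 i j := fun i j => by rw [← heuler i j]; ring
    have E' : ∀ i j, y 0 * (G 0 i j * x i * x j) = (((a i : AlgebraicClosure k) + a j + e) * F i j
      - y 1 * G 1 i j) * x i * x j := fun i j => by rw [← E]; ring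
    simp only [mul_add, E']
    rw [s1, s2, s3]
    linear_combination ((2 * a 0 + e) * x 0) * e0 + ((2 * a 1 + e) * x 1) * e1 +
      ((2 * a 2 + e) * x 2) * e2
  have hex : ∃ x : Fin 3 → AlgebraicClosure k, x ≠ 0 ∧ (∀ i, ∑ j, F i j * x j = 0) ∧
      ∀ s, bil (G s) x x = 0 := by
    by_cases h0 : y 0 = 0
    · have h1 : y 1 ≠ 0 := by
        intro h1
        apply hy
        funext s
        fin_cases s
        · exact h0
        · exact h1
      obtain ⟨x, hx, hrx, hq⟩ := exists_isotropic_of_linear r hr (hGs 0)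
      refine ⟨x, hx, hker x hrx, fun s => ?_⟩
      have := hsum x (hker x hrx)
      rw [h0, zero_mul, zero_add, mul_eq_zero, or_iff_right h1] at this
      fin_cases s
      · exact hq
      · exact this
    · obtain ⟨x, hx, hrx, hq⟩ := exists_isotropic_of_linear r hr (hGs 1)
      refine ⟨x, hx, hker x hrx, fun s => ?_⟩
      have := hsum x (hker x hrx)
      rw [hq, mul_zero, add_zero, mul_eq_zero, or_iff_right h0] at this
      fin_cases s
      · exact this
      · exact hq
  obtain ⟨x, hx, hFx, hGx⟩ := hex
  obtain ⟨s, hs⟩ := hs y x hy hx (by rw [aeval_Qk]; exact bil_eq_zero_of_mulVec hFx)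
  rcases s with s | s
  · exact hs (by rw [aeval_pderiv_inl]; exact hGx s)
  · refine hs ?_
    rw [aeval_pderiv_inr fun i j => (hf i j).1]
    have := hFx s
    simp only [hFdef, Matrix.of_apply] at this
    rw [this, mul_zero]

end Smoothness

section Nullstellensatz

variable {f : Fin 3 → Fin 3 → MvPolynomial (Fin (1 + 1)) (𝓞 k)}

/-- The ideal generated by the pivots of the generic conic, for integral changes of variables. -/
def pivotIdeal (f : Fin 3 → Fin 3 → MvPolynomial (Fin (1 + 1)) (𝓞 k)) :
    Ideal (MvPolynomial (Fin (1 + 1)) (𝓞 k)) :=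
  Ideal.span (Set.range fun P : Matrix (Fin 3) (Fin 3) ℤ =>
    pivot (P.map (Int.castRingHom _)) (Matrix.of f))

theorem exists_mul_X_pow_mem {a : Fin 3 → ℤ} {e : ℤ} (hf : DegOK a e f) (hs : IsSmoothX f)
    (i : Fin (1 + 1)) : ∃ (N : 𝓞 k) (M : ℕ), N ≠ 0 ∧ C N * X i ^ M ∈ pivotIdeal f := by
  let _ : Algebra (MvPolynomial (Fin (1 + 1)) (𝓞 k)) (MvPolynomial (Fin (1 + 1)) k) :=
    algebraMvPolynomial
  let φ := algebraMap (MvPolynomial (Fin (1 + 1)) (𝓞 k)) (MvPolynomial (Fin (1 + 1)) k)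
  have hφ : ∀ p, φ p = map (algebraMap (𝓞 k) k) p := fun p => rfl
  have h1 : (X i : MvPolynomial (Fin (1 + 1)) k) ∈ ((pivotIdeal f).map φ).radical := by
    rw [← vanishingIdeal_zeroLocus_eq_radical (K := AlgebraicClosure k), mem_vanishingIdeal_iff]
    intro y hy
    rw [mem_zeroLocus_iff] at hy
    have : y = 0 := by
      apply eq_zero_of_pivots hf hs
      intro P
      have h2 := hy _ (Ideal.mem_map_of_mem φ (Ideal.subset_span ⟨P, rfl⟩))
      rw [hφ, aeval_map_algebraMap'] at h2
      have h3 := map_pivot (aeval y : MvPolynomial (Fin (1 + 1)) (𝓞 k) →ₐ[𝓞 k] _).toRingHom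
        (P.map (Int.castRingHom _)) (Matrix.of f)
      simp only [AlgHom.toRingHom_eq_coe, RingHom.coe_coe] at h3
      rw [h2] at h3
      rw [h3]
      congr 1
      ext i j
      simp
    simp [this]
  obtain ⟨M, hM⟩ := h1
  obtain ⟨⟨⟨q, hq⟩, ⟨_, N, hN, rfl⟩⟩, hqN⟩ :=
    (IsLocalization.mem_map_algebraMap_iff ((nonZeroDivisors (𝓞 k)).map C)
      (MvPolynomial (Fin (1 + 1)) k)).1 hM
  refine ⟨N, M, nonZeroDivisors.ne_zero hN, ?_⟩
  have hinj : Function.Injective φ := by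
    rw [show (φ : _ → _) = MvPolynomial.map (algebraMap (𝓞 k) k) from funext hφ]
    exact map_injective _ (FaithfulSMul.algebraMap_injective _ _)
  have : C N * X i ^ M = q := by
    apply hinj
    change φ _ = φ _
    rw [← show _ = φ q from hqN, map_mul, map_pow, mul_comm]
    simp [hφ]
  rw [this]
  exact hq

theorem exists_pivot_bound {a : Fin 3 → ℤ} {e : ℤ} (hf : DegOK a e f) (hs : IsSmoothX f)
    {b : 𝓞 k} (hb : b ≠ 0) :
    ∃ β : 𝓞 k, β ≠ 0 ∧ ∀ z : Fin (1 + 1) → 𝓞 k, b ∈ Ideal.span (Set.range z) →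
      ∀ v : HeightOneSpectrum (𝓞 k), ∃ P : Matrix (Fin 3) (Fin 3) (𝓞 k),
        ordAt v (pivot P (Matrix.of fun i j => eval z (f i j))) ≤ ordAt v β := by
  obtain ⟨N₀, M₀, hN₀, h₀⟩ := exists_mul_X_pow_mem hf hs 0
  obtain ⟨N₁, M₁, hN₁, h₁⟩ := exists_mul_X_pow_mem hf hs 1
  have hβ : N₀ * N₁ * b ^ (M₀ + M₁) ≠ 0 := mul_ne_zero (mul_ne_zero hN₀ hN₁) (pow_ne_zero _ hb)
  refine ⟨N₀ * N₁ * b ^ (M₀ + M₁), hβ, fun z hz v => ?_⟩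
  by_contra! hlt
  set n := ordNat v (N₀ * N₁ * b ^ (M₀ + M₁)) with hn
  set J : Ideal (𝓞 k) := v.asIdeal ^ (n + 1) with hJ
  have hmap : ∀ p ∈ pivotIdeal f, eval z p ∈ J := by
    intro p hp
    refine Ideal.mem_comap.1 ((Ideal.span_le.2 ?_ : pivotIdeal f ≤ J.comap (eval z)) hp)
    rintro _ ⟨P, rfl⟩
    simp only [SetLike.mem_coe, Ideal.mem_comap]
    rw [map_pivot, hJ, ← le_ordAt]
    have h2 := hlt ((P.map (Int.castRingHom (MvPolynomial (Fin (1 + 1)) (𝓞 k)))).map (eval z))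
    rw [ordAt_eq_ordNat v hβ] at h2
    have h3 := Order.add_one_le_of_lt h2
    push_cast
    exact h3
  have hmem : N₀ * N₁ * b ^ (M₀ + M₁) ∈ J := by
    let J' : Ideal (𝓞 k) := Submodule.comap (LinearMap.mulLeft (𝓞 k) (N₀ * N₁)) J
    have hJ' : ∀ x, x ∈ J' ↔ N₀ * N₁ * x ∈ J := fun x => Iff.rfl
    rw [← hJ']
    obtain ⟨c, hc⟩ := Ideal.mem_span_range_iff_exists_fun.1 hz
    rw [← hc, Fin.sum_univ_two]
    refine Ideal.add_pow_mem_of_pow_mem_of_le (m := M₀) (n := M₁) _ ?_ ?_ (Nat.le_succ _)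
    · rw [mul_pow]
      refine Ideal.mul_mem_left _ _ ?_
      rw [hJ', mul_comm N₀, mul_assoc]
      refine Ideal.mul_mem_left _ _ ?_
      simpa using hmap _ h₀
    · rw [mul_pow]
      refine Ideal.mul_mem_left _ _ ?_
      rw [hJ', mul_assoc]
      refine Ideal.mul_mem_left _ _ ?_
      simpa using hmap _ h₁
  rw [hJ, ← le_ordAt, ordAt_eq_ordNat v hβ, ← hn] at hmem
  norm_cast at hmem
  omega

end Nullstellensatz

section Content

theorem exists_ne_zero_mem_all {R : Type*} [CommRing R] [IsDomain R] (S : Finset (Ideal R))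
    (hS : ∀ I ∈ S, I ≠ ⊥) : ∃ b : R, b ≠ 0 ∧ ∀ I ∈ S, b ∈ I := by
  classical
  induction S using Finset.induction_on with
  | empty => exact ⟨1, one_ne_zero, by simp⟩
  | insert I S hI ih =>
    obtain ⟨b, hb, hbS⟩ := ih fun J hJ => hS J (Finset.mem_insert_of_mem hJ)
    obtain ⟨c, hcI, hc⟩ := Submodule.exists_mem_ne_zero_of_ne_bot (hS I (Finset.mem_insert_self _ _))
    refine ⟨c * b, mul_ne_zero hc hb, fun J hJ => ?_⟩
    rcases Finset.mem_insert.1 hJ with rfl | hJ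
    · exact Ideal.mul_mem_right _ _ hcI
    · exact Ideal.mul_mem_left _ _ (hbS J hJ)

/-- Every point of projective space has an integral representative of bounded content. -/
theorem exists_integral_representative (𝒞 : Finset (Ideal (𝓞 k))) (h𝒞 : ∀ I ∈ 𝒞, I ≠ ⊥) :
    ∃ b : 𝓞 k, b ≠ 0 ∧ (∀ I ∈ 𝒞, b ∈ I) ∧ ∀ x : Fin 3 → k, x ≠ 0 →
      ∃ (μ : k) (x' : Fin 3 → 𝓞 k), μ ≠ 0 ∧ (∀ j, algebraMap (𝓞 k) k (x' j) = μ * x j) ∧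
        b ∈ Ideal.span (Set.range x') := by
  classical
  have := Fintype.ofFinite (ClassGroup (𝓞 k))
  choose R hR using ClassGroup.mk0_surjective (R := 𝓞 k)
  obtain ⟨b, hb, hbmem⟩ := exists_ne_zero_mem_all
    (𝒞 ∪ Finset.univ.image fun c => (R c : Ideal (𝓞 k))) (by
      intro I hI
      rcases Finset.mem_union.1 hI with hI | hI
      · exact h𝒞 I hI
      · obtain ⟨c, _, rfl⟩ := Finset.mem_image.1 hI
        exact nonZeroDivisors.ne_zero (R c).2)
  refine ⟨b, hb, fun I hI => hbmem I (Finset.mem_union_left _ hI), fun x hx => ?_⟩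
  obtain ⟨⟨d, hd⟩, hint⟩ := IsLocalization.exist_integer_multiples_of_finite
    (nonZeroDivisors (𝓞 k)) x
  choose x₁ hx₁ using hint
  have hd0 : algebraMap (𝓞 k) k d ≠ 0 := by
    simpa using nonZeroDivisors.ne_zero hd
  have hx₁' : ∀ j, algebraMap (𝓞 k) k (x₁ j) = algebraMap (𝓞 k) k d * x j := by
    intro j
    rw [hx₁ j, Algebra.smul_def]
  have hI : Ideal.span (Set.range x₁) ≠ ⊥ := by
    intro h
    apply hx
    funext j
    have h1 : x₁ j ∈ Ideal.span (Set.range x₁) := Ideal.subset_span ⟨j, rfl⟩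
    rw [h, Ideal.mem_bot] at h1
    have h2 := hx₁' j
    rw [h1, map_zero] at h2
    exact (mul_eq_zero.1 h2.symm).resolve_left hd0
  let I : nonZeroDivisors (Ideal (𝓞 k)) :=
    ⟨Ideal.span (Set.range x₁), mem_nonZeroDivisors_of_ne_zero hI⟩
  set c := ClassGroup.mk0 I with hc
  obtain ⟨s, t, hs, ht, hst⟩ := ClassGroup.mk0_eq_mk0_iff.1 (hc.symm.trans (hR c).symm)
  have hex : ∀ j, ∃ y ∈ (R c : Ideal (𝓞 k)), t * y = s * x₁ j := by
    intro j
    rw [← Ideal.mem_span_singleton_mul, ← hst]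
    exact Ideal.mul_mem_mul (Ideal.mem_span_singleton_self _) (Ideal.subset_span ⟨j, rfl⟩)
  choose x' hx'R hx' using hex
  have ht0 : algebraMap (𝓞 k) k t ≠ 0 := by simpa using ht
  have hs0 : algebraMap (𝓞 k) k s ≠ 0 := by simpa using hs
  refine ⟨algebraMap (𝓞 k) k s * algebraMap (𝓞 k) k d / algebraMap (𝓞 k) k t, x',
    div_ne_zero (mul_ne_zero hs0 hd0) ht0, fun j => ?_, ?_⟩
  · apply mul_left_cancel₀ ht0
    rw [← map_mul, hx', map_mul, hx₁']
    field_simp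
  · have hspan : Ideal.span (Set.range x') = (R c : Ideal (𝓞 k)) := by
      have h1 : Ideal.span {t} * Ideal.span (Set.range x') =
          Ideal.span {t} * (R c : Ideal (𝓞 k)) := by
        rw [← hst]
        change _ = Ideal.span {s} * Ideal.span (Set.range x₁)
        rw [Ideal.span_mul_span', Ideal.span_mul_span', Set.singleton_mul, Set.singleton_mul,
          ← Set.range_comp, ← Set.range_comp]
        congr 2
        funext j
        exact hx' j
      exact mul_left_cancel₀ (by simpa using ht) h1
    rw [hspan]
    exact hbmem _ (Finset.mem_union_right _ (Finset.mem_image_of_mem _ (Finset.mem_univ c)))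

end Content

section FinitePlaces

theorem fnorm_eq (v : HeightOneSpectrum (𝓞 k)) (x : k) :
    fnorm v x = NumberField.HeightOneSpectrum.adicAbv k v x := by
  rw [NumberField.HeightOneSpectrum.adicAbv_def, fnorm]
  by_cases h : v.valuation k x = 0
  · simp [h]
  · rw [dif_neg h, WithZeroMulInt.toNNReal_neg_apply _ h]
    push_cast
    rfl

theorem fnorm_algebraMap_le_one (v : HeightOneSpectrum (𝓞 k)) (x : 𝓞 k) :
    fnorm v (algebraMap (𝓞 k) k x) ≤ 1 := by
  rw [fnorm_eq]
  exact v.adicAbv_coe_le_one _ x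

theorem fnorm_algebraMap_eq_one {v : HeightOneSpectrum (𝓞 k)} {x : 𝓞 k} (hx : x ∉ v.asIdeal) :
    fnorm v (algebraMap (𝓞 k) k x) = 1 := by
  rw [fnorm_eq]
  exact (v.adicAbv_coe_eq_one_iff _ x).2 hx

theorem fnorm_pos (v : HeightOneSpectrum (𝓞 k)) {x : k} (hx : x ≠ 0) : 0 < fnorm v x := by
  rw [fnorm_eq]
  exact AbsoluteValue.pos _ hx

section Max

variable {ι : Type} [Fintype ι] [Nonempty ι] {z : ι → 𝓞 k}

theorem fnorm_le_maxAtFin (v : HeightOneSpectrum (𝓞 k)) (z : ι → k) (i : ι) :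
    fnorm v (z i) ≤ maxAtFin v z :=
  Finset.le_sup' (fun i => fnorm v (z i)) (Finset.mem_univ i)

theorem maxAtFin_le_one (v : HeightOneSpectrum (𝓞 k)) (z : ι → 𝓞 k) :
    maxAtFin v (fun i => algebraMap (𝓞 k) k (z i)) ≤ 1 :=
  Finset.sup'_le _ _ fun _ _ => fnorm_algebraMap_le_one v _

theorem fnorm_le_maxAtFin_of_mem_span (v : HeightOneSpectrum (𝓞 k)) {b : 𝓞 k}
    (hb : b ∈ Ideal.span (Set.range z)) :
    fnorm v (algebraMap (𝓞 k) k b) ≤ maxAtFin v fun i => algebraMap (𝓞 k) k (z i) := by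
  induction hb using Submodule.span_induction with
  | mem x h =>
    obtain ⟨i, rfl⟩ := h
    exact fnorm_le_maxAtFin v (fun i => algebraMap (𝓞 k) k (z i)) i
  | zero =>
    refine le_trans ?_ (fnorm_le_maxAtFin v (fun i => algebraMap (𝓞 k) k (z i)) (Classical.arbitrary ι))
    rw [map_zero, fnorm_eq, fnorm_eq, map_zero]
    exact AbsoluteValue.nonneg _ _
  | add x y _ _ hx hy =>
    rw [fnorm_eq] at hx hy ⊢
    rw [map_add]
    exact (NumberField.HeightOneSpectrum.adicAbv_add_le_max k v _ _).trans (max_le hx hy)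
  | smul c x _ hx =>
    rw [smul_eq_mul, map_mul, fnorm_eq, map_mul, ← fnorm_eq, ← fnorm_eq]
    refine le_trans (mul_le_of_le_one_left ?_ (fnorm_algebraMap_le_one v c)) hx
    rw [fnorm_eq]
    exact AbsoluteValue.nonneg _ _

theorem maxAtFin_eq_one {v : HeightOneSpectrum (𝓞 k)} {b : 𝓞 k}
    (hb : b ∈ Ideal.span (Set.range z)) (hv : b ∉ v.asIdeal) :
    maxAtFin v (fun i => algebraMap (𝓞 k) k (z i)) = 1 :=
  le_antisymm (maxAtFin_le_one v z)
    ((fnorm_algebraMap_eq_one hv).symm.le.trans (fnorm_le_maxAtFin_of_mem_span v hb))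

end Max

theorem le_finprod_of_le {b : 𝓞 k} (hb : b ≠ 0) {g l : HeightOneSpectrum (𝓞 k) → ℝ}
    (hg : ∀ v : HeightOneSpectrum (𝓞 k), b ∉ v.asIdeal → g v = 1)
    (hl : ∀ v, 0 ≤ l v) (hlg : ∀ v ∈ primesOf hb, l v ≤ g v) :
    ∏ v ∈ primesOf hb, l v ≤ ∏ᶠ v, g v := by
  rw [finprod_eq_prod_of_mulSupport_subset (s := primesOf hb) g]
  · exact Finset.prod_le_prod (fun v _ => hl v) hlg
  · intro v hv
    rw [Finset.mem_coe, mem_primesOf]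
    by_contra h
    exact hv (hg v h)

theorem rpow_abs_le_rpow {t m s : ℝ} (ht : 0 < t) (htm : t ≤ m) (hm : m ≤ 1) :
    t ^ |s| ≤ m ^ s := by
  have hmpos := ht.trans_le htm
  calc t ^ |s| ≤ m ^ |s| := Real.rpow_le_rpow ht.le htm (abs_nonneg s)
    _ ≤ m ^ s := Real.rpow_le_rpow_of_exponent_ge hmpos hm (le_abs_self s)

/-- The finite part of the height of a point with coordinates of bounded content. -/
theorem exists_le_finprod_height (A : ℝ) (a : Fin 3 → ℤ) {b : 𝓞 k} (hb : b ≠ 0) :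
    ∃ c : ℝ, 0 < c ∧ ∀ (z : Fin (1 + 1) → 𝓞 k) (x : Fin 3 → 𝓞 k),
      b ∈ Ideal.span (Set.range z) → b ∈ Ideal.span (Set.range x) →
      c ≤ ∏ᶠ v : HeightOneSpectrum (𝓞 k),
        (maxAtFin v (fun i => algebraMap (𝓞 k) k (z i)) ^ A *
          Finset.univ.sup' Finset.univ_nonempty
            (fun j => maxAtFin v (fun i => algebraMap (𝓞 k) k (z i)) ^ ((a j : ℤ) : ℝ) *
              fnorm v (algebraMap (𝓞 k) k (x j)))) := by
  have hbk : algebraMap (𝓞 k) k b ≠ 0 := by simpa using hb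
  set t : HeightOneSpectrum (𝓞 k) → ℝ := fun v => fnorm v (algebraMap (𝓞 k) k b) with ht
  have htpos : ∀ v, 0 < t v := fun v => fnorm_pos v hbk
  have ht1 : ∀ v, t v ≤ 1 := fun v => fnorm_algebraMap_le_one v b
  set S : ℝ := ∑ j, |(a j : ℝ)| with hS
  refine ⟨∏ v ∈ primesOf hb, t v ^ |A| * (t v ^ S * t v), ?_, fun z x hz hx => ?_⟩
  · refine Finset.prod_pos fun v _ => ?_
    have := htpos v
    positivity
  · apply le_finprod_of_le hb
    · intro v hv
      rw [maxAtFin_eq_one hz hv]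
      simp only [Real.one_rpow, one_mul]
      exact maxAtFin_eq_one hx hv
    · intro v
      have := htpos v
      positivity
    · intro v _
      have h1 := htpos v
      have hm1 := maxAtFin_le_one v z
      have hm2 : t v ≤ _ := fnorm_le_maxAtFin_of_mem_span v hz
      refine mul_le_mul (rpow_abs_le_rpow h1 hm2 hm1) ?_ (by positivity)
        (Real.rpow_nonneg (h1.le.trans hm2) _)
      obtain ⟨j, -, hj⟩ := Finset.exists_mem_eq_sup' Finset.univ_nonempty
        (fun j => fnorm v (algebraMap (𝓞 k) k (x j)))
      have hx2 : t v ≤ _ := fnorm_le_maxAtFin_of_mem_span v hx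
      rw [maxAtFin, hj] at hx2
      refine le_trans ?_ (Finset.le_sup' _ (Finset.mem_univ j))
      refine mul_le_mul ?_ hx2 h1.le (Real.rpow_nonneg (h1.le.trans hm2) _)
      refine le_trans ?_ (rpow_abs_le_rpow h1 hm2 hm1)
      refine Real.rpow_le_rpow_of_exponent_ge h1 (ht1 v) ?_
      exact Finset.single_le_sum (f := fun j => |(a j : ℝ)|) (fun j _ => abs_nonneg _)
        (Finset.mem_univ j)

/-- The height of a point is comparable with its archimedean part, given bounded content. -/
theorem exists_Hproj_bounds {b : 𝓞 k} (hb : b ≠ 0) :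
    ∃ c : ℝ, 0 < c ∧ ∀ z : Fin (1 + 1) → 𝓞 k, b ∈ Ideal.span (Set.range z) →
      Hproj (fun i => algebraMap (𝓞 k) k (z i)) ≤
          ∏ w : InfinitePlace k, maxAt w (fun i => algebraMap (𝓞 k) k (z i)) ^ w.mult ∧
        c * ∏ w : InfinitePlace k, maxAt w (fun i => algebraMap (𝓞 k) k (z i)) ^ w.mult ≤
          Hproj (fun i => algebraMap (𝓞 k) k (z i)) := by
  have hbk : algebraMap (𝓞 k) k b ≠ 0 := by simpa using hb
  refine ⟨∏ v ∈ primesOf hb, fnorm v (algebraMap (𝓞 k) k b),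
    Finset.prod_pos fun v _ => fnorm_pos v hbk, fun z hz => ?_⟩
  have h0 : 0 ≤ ∏ w : InfinitePlace k, maxAt w (fun i => algebraMap (𝓞 k) k (z i)) ^ w.mult := by
    refine Finset.prod_nonneg fun w _ => pow_nonneg ?_ _
    exact le_trans (apply_nonneg w _) (Finset.le_sup'
      (fun i => w (algebraMap (𝓞 k) k (z i))) (Finset.mem_univ 0))
  constructor
  · refine mul_le_of_le_one_right h0 ?_
    rw [finprod_eq_prod_of_mulSupport_subset (s := primesOf hb)]
    · exact Finset.prod_le_one (fun v _ => (fnorm_pos v hbk).le.trans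
        (fnorm_le_maxAtFin_of_mem_span v hz)) fun v _ => maxAtFin_le_one v z
    · intro v hv
      rw [Finset.mem_coe, mem_primesOf]
      by_contra h
      exact hv (maxAtFin_eq_one hz h)
  · rw [mul_comm, Hproj]
    refine mul_le_mul_of_nonneg_left ?_ h0
    exact le_finprod_of_le hb (fun v hv => maxAtFin_eq_one hz hv) (fun v => (fnorm_pos v hbk).le)
      fun v _ => fnorm_le_maxAtFin_of_mem_span v hz

end FinitePlaces

section Archimedean

/-- The archimedean part of the height of an integral point of the base. -/
def archZ (z : Fin (1 + 1) → 𝓞 k) : ℝ :=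
  ∏ w : InfinitePlace k, maxAt w (fun i => algebraMap (𝓞 k) k (z i)) ^ w.mult

/-- The weighted norm of a point of the fibre at an archimedean place. -/
def archNorm (a : Fin 3 → ℤ) (z : Fin (1 + 1) → 𝓞 k) (x : Fin 3 → 𝓞 k)
    (w : InfinitePlace k) : ℝ :=
  Finset.univ.sup' Finset.univ_nonempty
    fun j => maxAt w (fun i => algebraMap (𝓞 k) k (z i)) ^ ((a j : ℤ) : ℝ) *
      w (algebraMap (𝓞 k) k (x j))

/-- The archimedean part of the height of an integral point of the fibre. -/
def archX (a : Fin 3 → ℤ) (z : Fin (1 + 1) → 𝓞 k) (x : Fin 3 → 𝓞 k) : ℝ :=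
  ∏ w : InfinitePlace k, archNorm a z x w ^ w.mult

theorem absN_eq_prod (x : 𝓞 k) :
    (absN x : ℝ) = ∏ w : InfinitePlace k, w (algebraMap (𝓞 k) k x) ^ w.mult := by
  rw [InfinitePlace.prod_eq_abs_norm, ← Algebra.coe_norm_int, absN, ← Int.cast_abs,
    ← Nat.cast_natAbs]
  simp

theorem apply_sum_le {ι : Type*} (w : InfinitePlace k) (s : Finset ι) (g : ι → k) :
    w (∑ i ∈ s, g i) ≤ ∑ i ∈ s, w (g i) :=
  w.1.sum_le s g

theorem apply_neg (w : InfinitePlace k) (x : k) : w (-x) = w x :=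
  w.1.map_neg x

variable {z : Fin (1 + 1) → 𝓞 k}

theorem le_maxAt (w : InfinitePlace k) (i : Fin (1 + 1)) :
    w (algebraMap (𝓞 k) k (z i)) ≤ maxAt w (fun i => algebraMap (𝓞 k) k (z i)) :=
  Finset.le_sup' (fun i => w (algebraMap (𝓞 k) k (z i))) (Finset.mem_univ i)

theorem maxAt_pos (hz : z ≠ 0) (w : InfinitePlace k) :
    0 < maxAt w (fun i => algebraMap (𝓞 k) k (z i)) := by
  obtain ⟨i, hi⟩ := Function.ne_iff.1 hz
  refine lt_of_lt_of_le ?_ (le_maxAt w i)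
  rw [InfinitePlace.pos_iff]
  simpa using hi

theorem one_le_archZ (hz : z ≠ 0) : 1 ≤ archZ z := by
  obtain ⟨i, hi⟩ := Function.ne_iff.1 hz
  calc (1 : ℝ) ≤ absN (z i) := by exact_mod_cast one_le_absN hi
    _ = _ := absN_eq_prod _
    _ ≤ archZ z := by
      refine Finset.prod_le_prod (fun w _ => pow_nonneg (apply_nonneg w _) _) fun w _ => ?_
      exact pow_le_pow_left₀ (apply_nonneg w _) (le_maxAt w i) _

theorem prod_rpow_mult (hz : z ≠ 0) (s : ℝ) :
    ∏ w : InfinitePlace k, (maxAt w (fun i => algebraMap (𝓞 k) k (z i)) ^ s) ^ w.mult =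
      archZ z ^ s := by
  rw [archZ, ← Real.finsetProd_rpow _ _ fun w _ => pow_nonneg (maxAt_pos hz w).le _]
  refine Finset.prod_congr rfl fun w _ => ?_
  rw [← Real.rpow_natCast, ← Real.rpow_mul (maxAt_pos hz w).le, mul_comm,
    Real.rpow_mul (maxAt_pos hz w).le, Real.rpow_natCast]

theorem le_archNorm (a : Fin 3 → ℤ) (x : Fin 3 → 𝓞 k) (w : InfinitePlace k) (j : Fin 3) :
    maxAt w (fun i => algebraMap (𝓞 k) k (z i)) ^ ((a j : ℤ) : ℝ) *
      w (algebraMap (𝓞 k) k (x j)) ≤ archNorm a z x w :=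
  Finset.le_sup' (fun j => maxAt w (fun i => algebraMap (𝓞 k) k (z i)) ^ ((a j : ℤ) : ℝ) *
      w (algebraMap (𝓞 k) k (x j))) (Finset.mem_univ j)

theorem archNorm_nonneg (hz : z ≠ 0) (a : Fin 3 → ℤ) (x : Fin 3 → 𝓞 k) (w : InfinitePlace k) :
    0 ≤ archNorm a z x w :=
  le_trans (mul_nonneg (Real.rpow_nonneg (maxAt_pos hz w).le _) (apply_nonneg w _))
    (le_archNorm a x w 0)

theorem archX_nonneg (hz : z ≠ 0) (a : Fin 3 → ℤ) (x : Fin 3 → 𝓞 k) : 0 ≤ archX a z x :=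
  Finset.prod_nonneg fun w _ => pow_nonneg (archNorm_nonneg hz a x w) _

theorem archZ_rpow_le_archX (hz : z ≠ 0) (a : Fin 3 → ℤ) {x : Fin 3 → 𝓞 k} {j : Fin 3}
    (hx : x j ≠ 0) : archZ z ^ ((a j : ℤ) : ℝ) ≤ archX a z x := by
  have h1 : (1 : ℝ) ≤ absN (x j) := by exact_mod_cast one_le_absN hx
  calc archZ z ^ ((a j : ℤ) : ℝ) ≤ archZ z ^ ((a j : ℤ) : ℝ) * absN (x j) :=
        le_mul_of_one_le_right (Real.rpow_nonneg (zero_le_one.trans (one_le_archZ hz)) _) h1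
    _ ≤ archX a z x := by
      rw [← prod_rpow_mult hz, absN_eq_prod, ← Finset.prod_mul_distrib]
      have h0 : ∀ w : InfinitePlace k,
          0 ≤ maxAt w (fun i => algebraMap (𝓞 k) k (z i)) ^ ((a j : ℤ) : ℝ) :=
        fun w => Real.rpow_nonneg (maxAt_pos hz w).le _
      refine Finset.prod_le_prod (fun w _ => mul_nonneg (pow_nonneg (h0 w) _)
        (pow_nonneg (apply_nonneg w _) _)) fun w _ => ?_
      rw [← mul_pow]
      exact pow_le_pow_left₀ (mul_nonneg (h0 w) (apply_nonneg w _)) (le_archNorm a x w j) _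

theorem apply_le_archNorm (hz : z ≠ 0) (a : Fin 3 → ℤ) (x : Fin 3 → 𝓞 k) (w : InfinitePlace k)
    (j : Fin 3) : w (algebraMap (𝓞 k) k (x j)) ≤
      maxAt w (fun i => algebraMap (𝓞 k) k (z i)) ^ (-((a j : ℤ) : ℝ)) * archNorm a z x w := by
  rw [Real.rpow_neg (maxAt_pos hz w).le, ← div_eq_inv_mul,
    le_div_iff₀ (Real.rpow_pos_of_pos (maxAt_pos hz w) _), mul_comm]
  exact le_archNorm a x w j

theorem apply_det3_le (hz : z ≠ 0) (a : Fin 3 → ℤ) (x y u : Fin 3 → 𝓞 k) (w : InfinitePlace k) :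
    w (algebraMap (𝓞 k) k (det3 x y u)) ≤
      6 * maxAt w (fun i => algebraMap (𝓞 k) k (z i)) ^ (-(((a 0 : ℤ) : ℝ) + a 1 + a 2)) *
        (archNorm a z x w * archNorm a z y w * archNorm a z u w) := by
  have hM := maxAt_pos hz w
  have term : ∀ i j l : Fin 3, ((a i : ℤ) : ℝ) + a j + a l = ((a 0 : ℤ) : ℝ) + a 1 + a 2 →
      w (algebraMap (𝓞 k) k (x i * y j * u l)) ≤
        maxAt w (fun i => algebraMap (𝓞 k) k (z i)) ^ (-(((a 0 : ℤ) : ℝ) + a 1 + a 2)) *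
        (archNorm a z x w * archNorm a z y w * archNorm a z u w) := by
    intro i j l h
    rw [← h, neg_add, neg_add, Real.rpow_add hM, Real.rpow_add hM, map_mul, map_mul, map_mul,
      map_mul]
    have h1 := apply_le_archNorm hz a x w i
    have h2 := apply_le_archNorm hz a y w j
    have h3 := apply_le_archNorm hz a u w l
    have g1 := apply_nonneg w (algebraMap (𝓞 k) k (x i))
    have g2 := apply_nonneg w (algebraMap (𝓞 k) k (y j))
    have g3 := apply_nonneg w (algebraMap (𝓞 k) k (u l))
    refine (mul_le_mul (mul_le_mul h1 h2 g2 (g1.trans h1)) h3 g3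
      (mul_nonneg (g1.trans h1) (g2.trans h2))).trans (le_of_eq ?_)
    ring
  have hdet : det3 x y u = (x 0 * y 1 * u 2 + x 1 * y 2 * u 0 + x 2 * y 0 * u 1) -
      (x 0 * y 2 * u 1 + x 1 * y 0 * u 2 + x 2 * y 1 * u 0) := by
    rw [det3]; ring
  have hadd : ∀ p q : 𝓞 k, w (algebraMap (𝓞 k) k (p + q)) ≤
      w (algebraMap (𝓞 k) k p) + w (algebraMap (𝓞 k) k q) := by
    intro p q
    rw [map_add]
    exact w.1.add_le _ _
  have hsub : ∀ p q : 𝓞 k, w (algebraMap (𝓞 k) k (p - q)) ≤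
      w (algebraMap (𝓞 k) k p) + w (algebraMap (𝓞 k) k q) := by
    intro p q
    rw [map_sub]
    exact w.1.sub_le_add _ _
  rw [hdet]
  have t1 := term 0 1 2 rfl
  have t2 := term 1 2 0 (by ring)
  have t3 := term 2 0 1 (by ring)
  have t4 := term 0 2 1 (by ring)
  have t5 := term 1 0 2 (by ring)
  have t6 := term 2 1 0 (by ring)
  have s1 := hsub (x 0 * y 1 * u 2 + x 1 * y 2 * u 0 + x 2 * y 0 * u 1)
    (x 0 * y 2 * u 1 + x 1 * y 0 * u 2 + x 2 * y 1 * u 0)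
  have s2 := hadd (x 0 * y 1 * u 2 + x 1 * y 2 * u 0) (x 2 * y 0 * u 1)
  have s3 := hadd (x 0 * y 1 * u 2) (x 1 * y 2 * u 0)
  have s4 := hadd (x 0 * y 2 * u 1 + x 1 * y 0 * u 2) (x 2 * y 1 * u 0)
  have s5 := hadd (x 0 * y 2 * u 1) (x 1 * y 0 * u 2)
  linarith

variable (k) in
theorem exists_absN_det3_le (a : Fin 3 → ℤ) :
    ∃ C : ℝ, 0 < C ∧ ∀ z : Fin (1 + 1) → 𝓞 k, z ≠ 0 → ∀ x y u : Fin 3 → 𝓞 k,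
      (absN (det3 x y u) : ℝ) ≤ C * archZ z ^ (-(((a 0 : ℤ) : ℝ) + a 1 + a 2)) *
        (archX a z x * archX a z y * archX a z u) := by
  refine ⟨∏ w : InfinitePlace k, 6 ^ w.mult, Finset.prod_pos fun w _ => by positivity,
    fun z hz x y u => ?_⟩
  rw [absN_eq_prod, ← prod_rpow_mult hz, archX, archX, archX]
  simp only [← Finset.prod_mul_distrib, ← mul_pow]
  refine Finset.prod_le_prod (fun w _ => pow_nonneg (apply_nonneg w _) _) fun w _ => ?_
  exact pow_le_pow_left₀ (apply_nonneg w _) (apply_det3_le hz a x y u w) _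

theorem exists_apply_eval_le (w : InfinitePlace k) {p : MvPolynomial (Fin (1 + 1)) (𝓞 k)} {n : ℕ}
    (hp : p.IsHomogeneous n) :
    ∃ C : ℝ, 0 ≤ C ∧ ∀ z : Fin (1 + 1) → 𝓞 k, w (algebraMap (𝓞 k) k (eval z p)) ≤
      C * maxAt w (fun i => algebraMap (𝓞 k) k (z i)) ^ n := by
  refine ⟨∑ m ∈ p.support, w (algebraMap (𝓞 k) k (p.coeff m)),
    Finset.sum_nonneg fun m _ => apply_nonneg w _, fun z => ?_⟩
  have h0 : 0 ≤ maxAt w (fun i => algebraMap (𝓞 k) k (z i)) :=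
    (apply_nonneg w _).trans (le_maxAt w 0)
  rw [eval_eq', map_sum, Finset.sum_mul]
  refine (apply_sum_le w _ _).trans (Finset.sum_le_sum fun m hm => ?_)
  rw [map_mul, map_mul]
  refine mul_le_mul_of_nonneg_left ?_ (apply_nonneg w _)
  have hdeg : ∑ i, m i = n := by
    rw [← hp (mem_support_iff.1 hm), Finsupp.weight_apply, Finsupp.sum_fintype _ _ (by simp)]
    simp
  rw [map_prod, map_prod, ← hdeg, ← Finset.prod_pow_eq_pow_sum]
  refine Finset.prod_le_prod (fun i _ => apply_nonneg w _) fun i _ => ?_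
  rw [map_pow, map_pow]
  exact pow_le_pow_left₀ (apply_nonneg w _) (le_maxAt w i) _

theorem exists_absN_DeltaO_le {a : Fin 3 → ℤ} {e : ℤ}
    {f : Fin 3 → Fin 3 → MvPolynomial (Fin (1 + 1)) (𝓞 k)} (hf : DegOK a e f) :
    ∃ C : ℝ, 1 ≤ C ∧ ∀ z : Fin (1 + 1) → 𝓞 k, z ≠ 0 → (absN (DeltaO f z) : ℝ) ≤
      C * archZ z ^ |2 * (((a 0 : ℤ) : ℝ) + a 1 + a 2) + 3 * e| := by
  have hent : ∀ (w : InfinitePlace k) (i j : Fin 3), ∃ C : ℝ, 0 ≤ C ∧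
      ∀ z : Fin (1 + 1) → 𝓞 k, z ≠ 0 → w (algebraMap (𝓞 k) k (eval z (f i j))) ≤
        C * maxAt w (fun i => algebraMap (𝓞 k) k (z i)) ^ ((a i : ℝ) + a j + e) := by
    intro w i j
    rcases lt_or_ge (a i + a j + e) 0 with hneg | hpos
    · exact ⟨0, le_rfl, fun z _ => by simp [(hf i j).2.2 hneg]⟩
    · obtain ⟨C, hC, h⟩ := exists_apply_eval_le w (hf i j).2.1
      refine ⟨C, hC, fun z _ => (h z).trans (le_of_eq ?_)⟩
      rw [← Real.rpow_natCast]
      congr 2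
      rw [← Int.cast_natCast, Int.toNat_of_nonneg hpos]
      push_cast
      ring
  choose Cw hCw0 hCw using hent
  set D : InfinitePlace k → ℝ := fun w => ∑ i, ∑ j, Cw w i j with hD
  have hD0 : ∀ w, 0 ≤ D w := fun w =>
    Finset.sum_nonneg fun i _ => Finset.sum_nonneg fun j _ => hCw0 w i j
  have hCD : ∀ w i j, Cw w i j ≤ D w := fun w i j =>
    (Finset.single_le_sum (f := fun j => Cw w i j) (fun j _ => hCw0 w i j)
      (Finset.mem_univ j)).trans (Finset.single_le_sum (f := fun i => ∑ j, Cw w i j)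
      (fun i _ => Finset.sum_nonneg fun j _ => hCw0 w i j) (Finset.mem_univ i))
  refine ⟨1 + ∏ w : InfinitePlace k, (6 * D w ^ 3) ^ w.mult,
    le_add_of_nonneg_right (Finset.prod_nonneg fun w _ => ?_), fun z hz => ?_⟩
  · have := hD0 w
    positivity
  set E : ℝ := 2 * (((a 0 : ℤ) : ℝ) + a 1 + a 2) + 3 * e with hE
  have hplace : ∀ w : InfinitePlace k, w (algebraMap (𝓞 k) k (DeltaO f z)) ≤
      6 * D w ^ 3 * maxAt w (fun i => algebraMap (𝓞 k) k (z i)) ^ E := by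
    intro w
    set Mw := maxAt w (fun i => algebraMap (𝓞 k) k (z i)) with hMw
    have hM : 0 < Mw := maxAt_pos hz w
    have hb : ∀ i j, w (algebraMap (𝓞 k) k (eval z (f i j))) ≤
        D w * Mw ^ ((a i : ℝ) + a j + e) := fun i j =>
      (hCw w i j z hz).trans (mul_le_mul_of_nonneg_right (hCD w i j) (Real.rpow_nonneg hM.le _))
    have hperm : ∀ σ : Equiv.Perm (Fin 3),
        w (algebraMap (𝓞 k) k (∏ i, eval z (f (σ i) i))) ≤ D w ^ 3 * Mw ^ E := by
      intro σ
      rw [map_prod, map_prod]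
      refine (Finset.prod_le_prod (fun i _ => apply_nonneg w _) fun i _ => hb (σ i) i).trans ?_
      rw [Finset.prod_mul_distrib, Finset.prod_const, Finset.card_univ, Fintype.card_fin,
        ← Real.rpow_sum_of_pos hM]
      refine le_of_eq ?_
      congr 2
      rw [Finset.sum_add_distrib, Finset.sum_add_distrib,
        Equiv.sum_comp σ (fun i => (a i : ℝ)), hE]
      simp [Fin.sum_univ_three]
      ring
    rw [DeltaO, Matrix.det_apply, map_sum]
    refine (apply_sum_le w _ _).trans ?_
    refine (Finset.sum_le_card_nsmul _ _ (D w ^ 3 * Mw ^ E) fun σ _ => ?_).trans (le_of_eq ?_)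
    · have h1 : w (algebraMap (𝓞 k) k (Equiv.Perm.sign σ •
          ∏ i, Matrix.of (fun i j => eval z (f i j)) (σ i) i)) =
          w (algebraMap (𝓞 k) k (∏ i, eval z (f (σ i) i))) := by
        rcases Int.units_eq_one_or (Equiv.Perm.sign σ) with h | h <;> simp [h, apply_neg]
      rw [h1]
      exact hperm σ
    · simp [Fintype.card_perm, Nat.factorial]
      ring
  calc (absN (DeltaO f z) : ℝ) = _ := absN_eq_prod _
    _ ≤ ∏ w : InfinitePlace k, (6 * D w ^ 3 *
        maxAt w (fun i => algebraMap (𝓞 k) k (z i)) ^ E) ^ w.mult :=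
      Finset.prod_le_prod (fun w _ => pow_nonneg (apply_nonneg w _) _) fun w _ =>
        pow_le_pow_left₀ (apply_nonneg w _) (hplace w) _
    _ = (∏ w : InfinitePlace k, (6 * D w ^ 3) ^ w.mult) * archZ z ^ E := by
      rw [← prod_rpow_mult hz, ← Finset.prod_mul_distrib]
      exact Finset.prod_congr rfl fun w _ => mul_pow _ _ _
    _ ≤ _ := by
      have hZ := one_le_archZ hz
      refine mul_le_mul (by linarith) (Real.rpow_le_rpow_of_exponent_le hZ (le_abs_self E))
        (by positivity) ?_
      refine add_nonneg zero_le_one (Finset.prod_nonneg fun w _ => ?_)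
      have := hD0 w
      positivity

end Archimedean

section FibrePoints

variable {a : Fin 3 → ℤ} {e : ℤ} {α : ℚ} {f : Fin 3 → Fin 3 → MvPolynomial (Fin (1 + 1)) (𝓞 k)}

theorem exists_mul_le_Hstd (a : Fin 3 → ℤ) (e : ℤ) (α : ℚ)
    (f : Fin 3 → Fin 3 → MvPolynomial (Fin (1 + 1)) (𝓞 k)) {b : 𝓞 k} (hb : b ≠ 0) :
    ∃ c : ℝ, 0 < c ∧ ∀ (P : PtRep k 1 f) (z : Fin (1 + 1) → 𝓞 k) (x : Fin 3 → 𝓞 k),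
      z ≠ 0 → (P.y = fun i => algebraMap (𝓞 k) k (z i)) →
      (P.x = fun j => algebraMap (𝓞 k) k (x j)) →
      b ∈ Ideal.span (Set.range z) → b ∈ Ideal.span (Set.range x) →
      c * (archZ z ^ Aexp 1 a e α * archX a z x) ≤ Hstd a e α f P := by
  obtain ⟨c, hc, h⟩ := exists_le_finprod_height (Aexp 1 a e α) a hb
  refine ⟨c, hc, fun P z x hz hy hx hbz hbx => ?_⟩
  rw [Hstd, hy, hx, mul_comm c]
  refine mul_le_mul (le_of_eq ?_) (h z x hbz hbx) hc.le ?_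
  · rw [archX, ← prod_rpow_mult hz, ← Finset.prod_mul_distrib]
    exact Finset.prod_congr rfl fun w _ => (mul_pow _ _ _).symm
  · exact Finset.prod_nonneg fun w _ => pow_nonneg
      (mul_nonneg (Real.rpow_nonneg (maxAt_pos hz w).le _) (archNorm_nonneg hz a x w)) _

/-- The weighted homogeneity of the coefficients. -/
theorem aeval_smul_of_degOK (hf : DegOK a e f) (l : kˣ) (y : Fin (1 + 1) → k) (i j : Fin 3) :
    aeval (fun s => (l : k) * y s) (f i j) =
      ((l ^ (a i) * l ^ (a j) * l ^ e : kˣ) : k) * aeval y (f i j) := by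
  rcases lt_or_ge (a i + a j + e) 0 with hneg | hpos
  · simp [(hf i j).2.2 hneg]
  · have h := (hf i j).2.1
    have hl : ((l ^ (a i) * l ^ (a j) * l ^ e : kˣ) : k) = (l : k) ^ (a i + a j + e).toNat := by
      rw [← zpow_add, ← zpow_add, Units.val_zpow_eq_zpow_val, ← zpow_natCast,
        Int.toNat_of_nonneg hpos]
    rw [hl, aeval_def, aeval_def, eval₂_eq', eval₂_eq', Finset.mul_sum]
    refine Finset.sum_congr rfl fun m hm => ?_
    have hdeg : ∑ s, m s = (a i + a j + e).toNat := by
      rw [← h (mem_support_iff.1 hm), Finsupp.weight_apply, Finsupp.sum_fintype _ _ (by simp)]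
      simp
    simp only [mul_pow, Finset.prod_mul_distrib, Finset.prod_pow_eq_pow_sum, hdeg]
    ring

theorem exists_integral_point (hf : DegOK a e f) {b : 𝓞 k}
    (hrep : ∀ x : Fin 3 → k, x ≠ 0 →
      ∃ (μ : k) (x' : Fin 3 → 𝓞 k), μ ≠ 0 ∧ (∀ j, algebraMap (𝓞 k) k (x' j) = μ * x j) ∧
        b ∈ Ideal.span (Set.range x'))
    {z : Fin (1 + 1) → 𝓞 k} (hz : z ≠ 0) {P : PtRep k 1 f}
    (hP : P ∈ fiberSet f fun i => algebraMap (𝓞 k) k (z i)) :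
    ∃ (P' : PtRep k 1 f) (x : Fin 3 → 𝓞 k), ptRel a f P P' ∧
      (P'.y = fun i => algebraMap (𝓞 k) k (z i)) ∧
      (P'.x = fun j => algebraMap (𝓞 k) k (x j)) ∧ b ∈ Ideal.span (Set.range x) ∧
      bil (Matrix.of fun i j => eval z (f i j)) x x = 0 ∧ (P.x 2 ≠ 0 → x 2 ≠ 0) := by
  have hev : ∀ i j, algebraMap (𝓞 k) k (eval z (f i j)) =
      aeval (fun i => algebraMap (𝓞 k) k (z i)) (f i j) := fun i j => by
    rw [aeval_def, eval₂_eq', eval_eq']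
    simp
  obtain ⟨l, hl⟩ := hP
  have hx0 : (fun j => ((l⁻¹ ^ (-(a j)) : kˣ) : k) * P.x j) ≠ 0 := by
    obtain ⟨j, hj⟩ := Function.ne_iff.1 P.hx
    exact Function.ne_iff.2 ⟨j, mul_ne_zero (Units.ne_zero _) hj⟩
  obtain ⟨μ, x, hμ, hx, hbx⟩ := hrep _ hx0
  have hQ : bil (Matrix.of fun i j => eval z (f i j)) x x = 0 := by
    apply FaithfulSMul.algebraMap_injective (𝓞 k) k
    have hPy : P.y = fun s => (l : k) * algebraMap (𝓞 k) k (z s) := funext hl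
    have h0 := P.hQ
    rw [hPy] at h0
    simp only [aeval_smul_of_degOK hf] at h0
    rw [map_zero, ← mul_zero (μ ^ 2 * ((l ^ (-e) : kˣ) : k)), ← h0, bil, map_sum, Finset.mul_sum]
    refine Finset.sum_congr rfl fun i _ => ?_
    rw [map_sum, Finset.mul_sum]
    refine Finset.sum_congr rfl fun j _ => ?_
    simp only [Matrix.of_apply, map_mul, hx, hev, inv_zpow', neg_neg, Units.val_mul]
    have : ((l ^ (-e) : kˣ) : k) * ((l ^ e : kˣ) : k) = 1 := by
      rw [← Units.val_mul, ← zpow_add]; simp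
    linear_combination (-(μ ^ 2 * ((l ^ a i : kˣ) : k) * ((l ^ a j : kˣ) : k) *
      aeval (fun i => algebraMap (𝓞 k) k (z i)) (f i j) * P.x i * P.x j)) * this
  refine ⟨⟨fun i => algebraMap (𝓞 k) k (z i), fun j => algebraMap (𝓞 k) k (x j), ?_, ?_, ?_⟩, x,
    ⟨l⁻¹, Units.mk0 μ hμ, fun i => ?_, fun j => ?_⟩, rfl, rfl, hbx, hQ, fun h2 h => ?_⟩
  · obtain ⟨i, hi⟩ := Function.ne_iff.1 hz
    exact Function.ne_iff.2 ⟨i, by simpa using hi⟩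
  · obtain ⟨j, hj⟩ := Function.ne_iff.1 hx0
    exact Function.ne_iff.2 ⟨j, by
      rw [hx]
      exact mul_ne_zero hμ hj⟩
  · have := congrArg (algebraMap (𝓞 k) k) hQ
    simpa only [bil, map_sum, map_mul, Matrix.of_apply, hev, map_zero] using this
  · simp [hl i]
  · simp only [hx, Units.val_mul, Units.val_mk0]
    ring
  · have := hx 2
    rw [h, map_zero] at this
    exact mul_ne_zero hμ (mul_ne_zero (Units.ne_zero _) h2) this.symm

theorem mk_eq_mk_of_proportional {P Q : PtRep k 1 f} {x y : Fin 3 → 𝓞 k}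
    (hPQ : P.y = Q.y) (hP : P.x = fun j => algebraMap (𝓞 k) k (x j))
    (hQ : Q.x = fun j => algebraMap (𝓞 k) k (y j)) (h : ∀ i j, x i * y j = x j * y i) :
    Quot.mk (ptRel a f) P = Quot.mk (ptRel a f) Q := by
  have h' : ∀ i j, P.x i * Q.x j = P.x j * Q.x i := fun i j => by
    rw [hP, hQ]
    simp only [← map_mul, h i j]
  obtain ⟨s, hs⟩ := Function.ne_iff.1 P.hx
  have hs' : Q.x s ≠ 0 := by
    intro h0
    obtain ⟨t, ht⟩ := Function.ne_iff.1 Q.hx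
    have := h' s t
    rw [h0, mul_zero] at this
    exact (mul_ne_zero hs ht) this
  refine Quot.sound ⟨1, Units.mk0 (Q.x s / P.x s) (div_ne_zero hs' hs), fun i => ?_, fun j => ?_⟩
  · simp [hPQ]
  · have hs0 : P.x s ≠ 0 := hs
    simp only [one_zpow, one_mul, Units.val_mk0]
    field_simp
    linear_combination h' s j

end FibrePoints

section FibreCount

variable {a : Fin 3 → ℤ} {e : ℤ} {f : Fin 3 → Fin 3 → MvPolynomial (Fin (1 + 1)) (𝓞 k)}

theorem exists_pow_gt_le {q V : ℝ} (hq : 1 < q) (hV : 0 ≤ V) :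
    ∃ m : ℕ, m ≠ 0 ∧ V < q ^ m ∧ q ^ m ≤ q * (1 + V) := by
  obtain ⟨n, h1, h2⟩ := exists_nat_pow_near (le_add_of_nonneg_right hV : (1 : ℝ) ≤ 1 + V) hq
  refine ⟨n + 1, n.succ_ne_zero, by linarith, ?_⟩
  rw [pow_succ, mul_comm]
  exact mul_le_mul_of_nonneg_left h1 (by linarith)

/-- The number of integral points of bounded height on a conic fibre, in terms of an
auxiliary prime. -/
theorem card_fibre_points_le {z : Fin (1 + 1) → 𝓞 k} (hz : z ≠ 0) {b β : 𝓞 k}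
    (hsymm : ∀ i j, f i j = f j i) (hΔ : DeltaO f z ≠ 0) (hβ0 : β ≠ 0)
    (hβ : ∀ v : HeightOneSpectrum (𝓞 k), ∃ P : Matrix (Fin 3) (Fin 3) (𝓞 k),
      ordAt v (pivot P (Matrix.of fun i j => eval z (f i j))) ≤ ordAt v β)
    (v₀ : HeightOneSpectrum (𝓞 k)) (hv₀ : 2 * b * DeltaO f z ∉ v₀.asIdeal)
    {C₀ : ℝ} (hC₀ : 0 < C₀)
    (hdet3 : ∀ x y u : Fin 3 → 𝓞 k,
      (absN (det3 x y u) : ℝ) ≤ C₀ * archZ z ^ (-(((a 0 : ℤ) : ℝ) + a 1 + a 2)) *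
        (archX a z x * archX a z y * archX a z u))
    {T : Type} (x : T → Fin 3 → 𝓞 k)
    (hx : ∀ p, bil (Matrix.of fun i j => eval z (f i j)) (x p) (x p) = 0)
    (hb : ∀ p, b ∈ Ideal.span (Set.range (x p)))
    (hinj : ∀ p q, (∀ i j, x p i * x q j = x p j * x q i) → p = q)
    {R : ℝ} (hR : 0 ≤ R) (hxR : ∀ p, archX a z (x p) ≤ R) :
    (Nat.card T : ℝ) ≤ 18 * tauSq hΔ * (Ideal.absNorm v₀.asIdeal : ℝ) ^ 2 *
      (1 + (C₀ * absN (4 * β ^ 3)) ^ (1 / 3 : ℝ) *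
        archZ z ^ (-((((a 0 : ℤ) : ℝ) + a 1 + a 2) / 3)) *
        (absN (DeltaO f z) : ℝ) ^ (-(1 : ℝ) / 3) * R) := by
  set s : ℝ := ((a 0 : ℤ) : ℝ) + a 1 + a 2 with hs
  set N : ℝ := (absN (DeltaO f z) : ℝ) with hN
  have hN1 : 1 ≤ N := Nat.one_le_cast.2 <| one_le_absN hΔ
  have hZ : 0 < archZ z := zero_lt_one.trans_le (one_le_archZ hz)
  set K : ℝ := (absN (4 * β ^ 3) : ℝ) with hK
  have hβ4 : (4 * β ^ 3 : 𝓞 k) ≠ 0 := mul_ne_zero (by norm_num) (pow_ne_zero _ hβ0)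
  have hK1 : 1 ≤ K := Nat.one_le_cast.2 <| one_le_absN hβ4
  set q : ℝ := (Ideal.absNorm v₀.asIdeal : ℝ) with hq
  have hq2 : 2 ≤ q := two_le_absNorm v₀
  set V : ℝ := (C₀ * K) ^ (1 / 3 : ℝ) * archZ z ^ (-(s / 3)) * N ^ (-(1 : ℝ) / 3) * R with hV
  have hV0 : 0 ≤ V := by positivity
  have cube : ∀ {c : ℝ} (t : ℝ), 0 < c → (c ^ t) ^ 3 = c ^ (t * 3) := fun t hc => by
    rw [← Real.rpow_natCast, ← Real.rpow_mul hc.le]; norm_num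
  have hV3 : V ^ 3 = C₀ * K * archZ z ^ (-s) * N⁻¹ * R ^ 3 := by
    rw [hV, mul_pow, mul_pow, mul_pow, cube _ (by positivity), cube _ hZ, cube _ (by linarith),
      show (1 / 3 : ℝ) * 3 = 1 by norm_num, show -(s / 3) * 3 = -s by ring,
      show (-(1 : ℝ) / 3) * 3 = -1 by norm_num, Real.rpow_one, Real.rpow_neg_one]
  obtain ⟨m, hm0, hm1, hm2⟩ := exists_pow_gt_le (by linarith : 1 < q) hV0
  have hnot : ∀ {c : 𝓞 k}, c ∣ 2 * b * DeltaO f z → c ∉ v₀.asIdeal := fun h hc =>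
    hv₀ (v₀.asIdeal.mem_of_dvd h hc)
  have hcard := card_solutions_le (F := Matrix.of fun i j => eval z (f i j))
    (fun i j => by simp [hsymm i j]) hΔ hβ0 hβ v₀ (hnot ⟨b, by rw [DeltaO]; ring⟩) hm0 x hx
    (fun p => by
      by_contra! h
      exact hnot ⟨2 * DeltaO f z, by ring⟩
        ((Ideal.span_le.2 (by rintro _ ⟨i, rfl⟩; exact h i)) (hb p))) hinj
    (fun p₁ p₂ p₃ => by
      have hD := hdet3 (x p₁) (x p₂) (x p₃)
      have hD' : (absN (det3 (x p₁) (x p₂) (x p₃)) : ℝ) ≤ C₀ * archZ z ^ (-s) * R ^ 3 := by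
        refine hD.trans (mul_le_mul_of_nonneg_left ?_ (by positivity))
        rw [pow_three']
        exact mul_le_mul (mul_le_mul (hxR _) (hxR _) (archX_nonneg hz _ _) hR) (hxR _)
          (archX_nonneg hz _ _) (by positivity)
      have hlt : V ^ 6 < q ^ (6 * m) := by
        rw [mul_comm, pow_mul]
        exact pow_lt_pow_left₀ hm1 hV0 (by norm_num)
      have key : K * (absN (det3 (x p₁) (x p₂) (x p₃)) : ℝ) ^ 2 < N ^ 2 * q ^ (6 * m) := by
        calc K * (absN (det3 (x p₁) (x p₂) (x p₃)) : ℝ) ^ 2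
            ≤ K * (C₀ * archZ z ^ (-s) * R ^ 3) ^ 2 := by gcongr
          _ ≤ K ^ 2 * (C₀ * archZ z ^ (-s) * R ^ 3) ^ 2 := by
            gcongr
            exact le_self_pow₀ hK1 two_ne_zero
          _ = N ^ 2 * V ^ 6 := by
            rw [show V ^ 6 = (V ^ 3) ^ 2 by ring, hV3]
            field_simp
          _ < _ := mul_lt_mul_of_pos_left hlt (by positivity)
      rw [hK, hN, hq, DeltaO] at key
      exact_mod_cast key)
  have hcard' : (Nat.card T : ℝ) ≤ 2 * (tauSq hΔ * (9 * (q ^ m * q))) := by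
    rw [hq]
    exact_mod_cast hcard
  calc (Nat.card T : ℝ) ≤ 2 * (tauSq hΔ * (9 * (q ^ m * q))) := hcard'
    _ ≤ 2 * (tauSq hΔ * (9 * (q * (1 + V) * q))) := by gcongr
    _ = _ := by ring

end FibreCount

/-- The auxiliary factors in the fibre count are negligible. -/
theorem exists_tauSq_mul_sq_le {a : Fin 3 → ℤ} {e : ℤ}
    {f : Fin 3 → Fin 3 → MvPolynomial (Fin (1 + 1)) (𝓞 k)} (hf : DegOK a e f) {b : 𝓞 k}
    (hb : b ≠ 0) {ε : ℝ} (hε : 0 < ε) :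
    ∃ C : ℝ, 0 < C ∧ ∀ z : Fin (1 + 1) → 𝓞 k, z ≠ 0 → ∀ hΔ : DeltaO f z ≠ 0,
      ∃ v : HeightOneSpectrum (𝓞 k), 2 * b * DeltaO f z ∉ v.asIdeal ∧
        (tauSq hΔ : ℝ) * (Ideal.absNorm v.asIdeal : ℝ) ^ 2 ≤ C * archZ z ^ ε := by
  obtain ⟨CΔ, hCΔ, hΔle⟩ := exists_absN_DeltaO_le hf
  set κ : ℝ := |2 * (((a 0 : ℤ) : ℝ) + a 1 + a 2) + 3 * e| with hκ
  have hκ0 : 0 ≤ κ := abs_nonneg _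
  set δ : ℝ := ε / (3 * κ + 1) with hδdef
  have hδ : 0 < δ := by positivity
  have hδε : κ * (δ * 3) ≤ ε := by
    rw [hδdef, ← sub_nonneg, show ε - κ * (ε / (3 * κ + 1) * 3) = ε / (3 * κ + 1) by
      field_simp; ring]
    positivity
  obtain ⟨C₁, hC₁, h₁⟩ := exists_tauSq_le k hδ
  obtain ⟨C₂, hC₂, h₂⟩ := exists_prime_absNorm_le k hδ
  set M : ℝ := (absN (2 * b) : ℝ) ^ δ with hM
  have hb2 : (2 * b : 𝓞 k) ≠ 0 := mul_ne_zero two_ne_zero hb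
  have hM0 : 0 < M := Real.rpow_pos_of_pos (by exact_mod_cast one_le_absN hb2) _
  refine ⟨C₁ * (C₂ * M) ^ 2 * CΔ ^ (δ * 3), by positivity, fun z hz hΔ => ?_⟩
  obtain ⟨v, hv, hvN⟩ := h₂ (2 * b * DeltaO f z) (mul_ne_zero hb2 hΔ)
  refine ⟨v, hv, ?_⟩
  have hZ := one_le_archZ hz
  set N : ℝ := (absN (DeltaO f z) : ℝ) with hN
  have hN0 : 0 ≤ N := Nat.cast_nonneg _
  rw [absN_mul, Nat.cast_mul, Real.mul_rpow (Nat.cast_nonneg _) hN0, ← mul_assoc] at hvN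
  calc (tauSq hΔ : ℝ) * (Ideal.absNorm v.asIdeal : ℝ) ^ 2
      ≤ C₁ * N ^ δ * (C₂ * M * N ^ δ) ^ 2 := by
        gcongr
        exact h₁ _ hΔ
    _ = C₁ * (C₂ * M) ^ 2 * N ^ (δ * 3) := by
        have : N ^ (δ * 3) = (N ^ δ) ^ 3 := by
          rw [Real.rpow_mul hN0]; norm_cast
        rw [this]; ring
    _ ≤ C₁ * (C₂ * M) ^ 2 * (CΔ * archZ z ^ κ) ^ (δ * 3) := by
        gcongr
        exact hΔle z hz
    _ = C₁ * (C₂ * M) ^ 2 * CΔ ^ (δ * 3) * archZ z ^ (κ * (δ * 3)) := by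
        rw [Real.mul_rpow (by positivity) (by positivity), ← Real.rpow_mul (by positivity)]
        ring
    _ ≤ _ := by
        gcongr

theorem exists_archZ_rpow_le {b : 𝓞 k} (hb : b ≠ 0) (t : ℝ) :
    ∃ C : ℝ, 0 < C ∧ ∀ z : Fin (1 + 1) → 𝓞 k, z ≠ 0 → b ∈ Ideal.span (Set.range z) →
      archZ z ^ t ≤ C * Hproj (fun i => algebraMap (𝓞 k) k (z i)) ^ t := by
  obtain ⟨c, hc, h⟩ := exists_Hproj_bounds hb
  refine ⟨max 1 (c⁻¹ ^ t), by positivity, fun z hz hbz => ?_⟩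
  have hZ := zero_lt_one.trans_le (one_le_archZ hz)
  obtain ⟨h1, h2⟩ : Hproj (fun i => algebraMap (𝓞 k) k (z i)) ≤ archZ z ∧
      c * archZ z ≤ Hproj (fun i => algebraMap (𝓞 k) k (z i)) := h z hbz
  have hH : 0 < Hproj (fun i => algebraMap (𝓞 k) k (z i)) := (mul_pos hc hZ).trans_le h2
  rcases le_total 0 t with ht | ht
  · have h3 : archZ z ≤ c⁻¹ * Hproj (fun i => algebraMap (𝓞 k) k (z i)) := by
      rwa [inv_mul_eq_div, le_div_iff₀ hc, mul_comm]
    refine (Real.rpow_le_rpow hZ.le h3 ht).trans ?_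
    rw [Real.mul_rpow (inv_pos.2 hc).le hH.le]
    gcongr
    exact le_max_right _ _
  · refine (Real.rpow_le_rpow_of_nonpos hH h1 ht).trans ?_
    exact le_mul_of_one_le_left (by positivity) (le_max_left _ _)

/-- Lemma 3.10 / `lem:s_t_height_bound`: the refined fibre-wise
upper bound in the conic bundle surface case `n = 1`. -/
theorem statement_13
    (k : Type) [Field k] [NumberField k]
    (a : Fin 3 → ℤ) (ha : a 0 ≤ a 1 ∧ a 1 ≤ a 2) (e : ℤ)
    (f : Fin 3 → Fin 3 → MvPolynomial (Fin (1 + 1)) (𝓞 k))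
    (hf : DegOK a e f) (hsmooth : IsSmoothX f)
    -- a fixed finite set of integral ideals representing the ideal classes of `k`:
    (𝒞 : Finset (Ideal (𝓞 k))) (h𝒞 : ∀ I ∈ 𝒞, I ≠ ⊥)
    (α : ℚ) (hα : (a 0 : ℚ) + (a 1 : ℚ) + (e : ℚ) < α)
    (H : PtRep k 1 f → ℝ)
    (hHpos : ∀ P, 0 < H P)
    (hHinv : ∀ P P', ptRel a f P P' → H P = H P')
    (hH : ∃ c₁ c₂ : ℝ, 0 < c₁ ∧ c₁ ≤ c₂ ∧ ∀ P,
      c₁ * Hstd a e α f P ≤ H P ∧ H P ≤ c₂ * Hstd a e α f P)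
    (U : Set (PtRep k 1 f))
    (ι : Type) (g : ι → MvPolynomial (Fin (1 + 1) ⊕ Fin 3) k)
    (hg : ∀ i, IsBihom a (g i))
    (hUopen : U = {P | ∃ i, eval (Sum.elim P.y P.x) (g i) ≠ 0})
    (hUne : U.Nonempty)
    (hUΔ : ∀ P ∈ U, Deltak f P.y ≠ 0)
    (hUx : ∀ P ∈ U, P.x 2 ≠ 0) :
    ∀ ε : ℝ, 0 < ε → ∃ C : ℝ, 0 < C ∧
      ∀ (z : Fin (1 + 1) → 𝓞 k), Ideal.span (Set.range z) ∈ 𝒞 → DeltaO f z ≠ 0 →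
        ∀ B : ℝ, 0 < B →
          (Ncount a f (U ∩ fiberSet f fun i => algebraMap (𝓞 k) k (z i)) H B : ℝ) / B ≤
            C * (Hproj (fun i => algebraMap (𝓞 k) k (z i)) ^
                  (-(((((a 0 : ℤ) : ℝ) + ((a 1 : ℤ) : ℝ) + ((a 2 : ℤ) : ℝ)) / 3)
                      + Aexp 1 a e α) + ε) *
                  ((Algebra.norm ℤ (DeltaO f z)).natAbs : ℝ) ^ (-(1 : ℝ) / 3) +
                Hproj (fun i => algebraMap (𝓞 k) k (z i)) ^
                  (-(Aexp 1 a e α + ((a 2 : ℤ) : ℝ)) + ε)) := by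
  obtain ⟨c₁, _, hc₁, _, hH⟩ := hH
  obtain ⟨b, hb, hb𝒞, hrep⟩ := exists_integral_representative 𝒞 h𝒞
  obtain ⟨β, hβ0, hβ⟩ := exists_pivot_bound hf hsmooth hb
  obtain ⟨c₃, hc₃, hHstd⟩ := exists_mul_le_Hstd a e α f hb
  obtain ⟨C₀, hC₀, hdet3⟩ := exists_absN_det3_le k a
  intro ε hε
  obtain ⟨C₄, hC₄, haux⟩ := exists_tauSq_mul_sq_le hf hb hε
  set A := Aexp 1 a e α with hA
  set s : ℝ := ((a 0 : ℤ) : ℝ) + ((a 1 : ℤ) : ℝ) + ((a 2 : ℤ) : ℝ) with hs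
  obtain ⟨C₅, hC₅, h₅⟩ := exists_archZ_rpow_le hb (-(s / 3 + A) + ε)
  obtain ⟨C₆, hC₆, h₆⟩ := exists_archZ_rpow_le hb (-(A + ((a 2 : ℤ) : ℝ)) + ε)
  set K : ℝ := (C₀ * absN (4 * β ^ 3)) ^ (1 / 3 : ℝ) with hK
  have hK0 : 0 ≤ K := by positivity
  set D : ℝ := 18 * C₄ / (c₁ * c₃) with hD
  have hD0 : 0 < D := by positivity
  refine ⟨D * (C₆ + K * C₅), by positivity, fun z hz𝒞 hΔ B hB => ?_⟩
  have hbz : b ∈ Ideal.span (Set.range z) := hb𝒞 _ hz𝒞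
  have hz : z ≠ 0 := by
    rintro rfl
    refine hb ?_
    simpa using hbz
  have hZ1 := one_le_archZ hz
  have hZ0 : 0 < archZ z := zero_lt_one.trans_le hZ1
  have hHp : 0 ≤ Hproj (fun i => algebraMap (𝓞 k) k (z i)) := by
    obtain ⟨c, hc, h⟩ := exists_Hproj_bounds hb
    exact (mul_pos hc hZ0).le.trans (h z hbz).2
  set Y := Hproj (fun i => algebraMap (𝓞 k) k (z i)) with hY
  change (Nat.card {q : Quot (ptRel a f) // ∃ P,
    P ∈ (U ∩ fiberSet f fun i => algebraMap (𝓞 k) k (z i)) ∧ H P ≤ B ∧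
      Quot.mk (ptRel a f) P = q} : ℝ) / B ≤ D * (C₆ + K * C₅) *
      (Y ^ (-(s / 3 + A) + ε) * (absN (DeltaO f z) : ℝ) ^ (-(1 : ℝ) / 3) +
        Y ^ (-(A + ((a 2 : ℤ) : ℝ)) + ε))
  set S := {q : Quot (ptRel a f) // ∃ P,
    P ∈ (U ∩ fiberSet f fun i => algebraMap (𝓞 k) k (z i)) ∧ H P ≤ B ∧
      Quot.mk (ptRel a f) P = q} with hS
  set X : ℝ := (absN (DeltaO f z) : ℝ) ^ (-(1 : ℝ) / 3) with hX
  have hX0 : 0 ≤ X := by positivity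
  have hsel : ∀ p : S, ∃ (x : Fin 3 → 𝓞 k) (P : PtRep k 1 f), Quot.mk (ptRel a f) P = p.1 ∧
      (P.y = fun i => algebraMap (𝓞 k) k (z i)) ∧ (P.x = fun j => algebraMap (𝓞 k) k (x j)) ∧
      b ∈ Ideal.span (Set.range x) ∧
      bil (Matrix.of fun i j => eval z (f i j)) x x = 0 ∧ x 2 ≠ 0 ∧ H P ≤ B := by
    rintro ⟨q, P, ⟨hPU, hPz⟩, hPB, rfl⟩
    obtain ⟨P', x, hrel, hy, hx, hbx, hQ, h2⟩ := exists_integral_point hf hrep hz hPz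
    exact ⟨x, P', (Quot.sound hrel).symm, hy, hx, hbx, hQ, h2 (hUx P hPU),
      (hHinv P P' hrel).symm.trans_le hPB⟩
  choose x P hPq hPy hPx hbx hQ hx2 hPB using hsel
  set R : ℝ := B / (c₁ * c₃ * archZ z ^ A) with hR
  have hZA : 0 < archZ z ^ A := Real.rpow_pos_of_pos hZ0 _
  have hR0 : 0 ≤ R := by positivity
  have hxR : ∀ p, archX a z (x p) ≤ R := fun p => by
    rw [hR, le_div_iff₀ (by positivity)]
    have h1 := mul_le_mul_of_nonneg_left
      (hHstd (P p) z (x p) hz (hPy p) (hPx p) hbz (hbx p)) hc₁.le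
    refine le_trans (le_of_eq ?_) (h1.trans ((hH (P p)).1.trans (hPB p)))
    ring
  obtain ⟨v, hv, hvle⟩ := haux z hz hΔ
  have hcard := card_fibre_points_le hz (fun i j => (hf i j).1) hΔ hβ0 (hβ z hbz) v hv hC₀
    (hdet3 z hz) x hQ hbx (fun p q h => Subtype.ext <| by
      rw [← hPq p, ← hPq q]
      exact mk_eq_mk_of_proportional ((hPy p).trans (hPy q).symm) (hPx p) (hPx q) h) hR0 hxR
  have hbound : (Nat.card S : ℝ) ≤ 18 * (C₄ * archZ z ^ ε) *
      ((archZ z ^ (-((a 2 : ℤ) : ℝ)) + K * archZ z ^ (-(s / 3)) * X) * R) := by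
    rcases isEmpty_or_nonempty S with hemp | ⟨⟨p⟩⟩
    · rw [Nat.card_of_isEmpty, Nat.cast_zero]
      positivity
    · have hone : 1 ≤ archZ z ^ (-((a 2 : ℤ) : ℝ)) * R := by
        rw [Real.rpow_neg hZ0.le, inv_mul_eq_div, one_le_div (Real.rpow_pos_of_pos hZ0 _)]
        exact (archZ_rpow_le_archX hz a (hx2 p)).trans (hxR p)
      refine hcard.trans ?_
      rw [mul_assoc 18]
      refine mul_le_mul (mul_le_mul_of_nonneg_left hvle (by norm_num)) ?_ (by positivity)
        (by positivity)
      rw [add_mul]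
      gcongr
  have hsplit : ∀ t : ℝ, archZ z ^ (-(t + A) + ε) =
      archZ z ^ ε * archZ z ^ (-t) / archZ z ^ A := fun t => by
    rw [← Real.rpow_add hZ0, ← Real.rpow_sub hZ0]
    congr 1
    ring
  calc (Nat.card S : ℝ) / B ≤ 18 * (C₄ * archZ z ^ ε) *
      ((archZ z ^ (-((a 2 : ℤ) : ℝ)) + K * archZ z ^ (-(s / 3)) * X) * R) / B := by gcongr
    _ = D * (archZ z ^ (-(A + ((a 2 : ℤ) : ℝ)) + ε) +
        K * (archZ z ^ (-(s / 3 + A) + ε) * X)) := by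
      rw [add_comm A, hsplit, hsplit, hR, hD]
      field_simp
    _ ≤ D * (C₆ * Y ^ (-(A + ((a 2 : ℤ) : ℝ)) + ε) +
        K * (C₅ * Y ^ (-(s / 3 + A) + ε) * X)) := by
      gcongr
      · exact h₆ z hz hbz
      · exact h₅ z hz hbz
    _ ≤ D * (C₆ + K * C₅) * (Y ^ (-(s / 3 + A) + ε) * X +
        Y ^ (-(A + ((a 2 : ℤ) : ℝ)) + ε)) := by
      rw [mul_assoc D]
      refine mul_le_mul_of_nonneg_left ?_ hD0.le
      have h1 : 0 ≤ C₆ * (Y ^ (-(s / 3 + A) + ε) * X) := by positivity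
      have h2 : 0 ≤ K * C₅ * Y ^ (-(A + ((a 2 : ℤ) : ℝ)) + ε) := by positivity
      linarith

end Stmt
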